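/- arXiv:1609.02870 — 5 statements merged into one kernel-verified Lean document; each statement's English description precedes it below -/
import Mathlib

section
/- For every real number r with 0 < r ≤ 2, the only compact subgroup of G_r is the trivial subgroup. -/
open Matrix

open Matrix

/-- The group `G_r`: the subgroup of `GL(3, ℝ)` of matrices
`[[a^r, b, x], [0, a, y], [0, 0, 1]]` with `a > 0` and `b, x, y ∈ ℝ`. -/
noncomputable def Gr (r : ℝ) : Subgroup (GL (Fin 3) ℝ) where
  carrier := {g | ∃ a b x y : ℝ, 0 < a ∧
    (g : Matrix (Fin 3) (Fin 3) ℝ) = !![a ^ r, b, x; 0, a, y; 0, 0, 1]}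
  one_mem' := ⟨1, 0, 0, 0, one_pos, by
    simp [Units.val_one, Matrix.one_fin_three, Real.one_rpow]⟩
  mul_mem' := by
    rintro g g' ⟨a, b, x, y, ha, hg⟩ ⟨a', b', x', y', ha', hg'⟩
    refine ⟨a * a', a ^ r * b' + b * a', a ^ r * x' + b * y' + x, a * y' + y,
      mul_pos ha ha', ?_⟩
    rw [Units.val_mul, hg, hg', Matrix.mul_fin_three, Real.mul_rpow ha.le ha'.le]
    ext i j
    fin_cases i <;> fin_cases j <;> simp
  inv_mem' := by
    rintro g ⟨a, b, x, y, ha, hg⟩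
    have har : (0:ℝ) < a ^ r := Real.rpow_pos_of_pos ha r
    refine ⟨a⁻¹, -b * a⁻¹ * (a ^ r)⁻¹, (b * y * a⁻¹ - x) * (a ^ r)⁻¹, -y * a⁻¹,
      inv_pos.2 ha, ?_⟩
    set N : Matrix (Fin 3) (Fin 3) ℝ :=
      !![(a⁻¹) ^ r, -b * a⁻¹ * (a ^ r)⁻¹, (b * y * a⁻¹ - x) * (a ^ r)⁻¹;
         0, a⁻¹, -y * a⁻¹; 0, 0, 1] with hNdef
    have hinv : (a⁻¹ : ℝ) ^ r = (a ^ r)⁻¹ := Real.inv_rpow ha.le r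
    have hN : (↑g : Matrix (Fin 3) (Fin 3) ℝ) * N = 1 := by
      rw [hg, hNdef, Matrix.mul_fin_three, Matrix.one_fin_three, hinv]
      ext i j
      fin_cases i <;> fin_cases j <;>
        · simp
          try field_simp
          try ring
    calc (↑(g⁻¹) : Matrix (Fin 3) (Fin 3) ℝ)
        = ↑(g⁻¹) * ((↑g : Matrix (Fin 3) (Fin 3) ℝ) * N) := by rw [hN, mul_one]
      _ = (↑(g⁻¹) * (↑g : Matrix (Fin 3) (Fin 3) ℝ)) * N := by rw [mul_assoc]
      _ = N := by rw [← Units.val_mul, inv_mul_cancel, Units.val_one, one_mul]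

theorem eq_zero_of_nat_mul_bdd (t C : ℝ) (h : ∀ n : ℕ, |(n : ℝ) * t| ≤ C) : t = 0 := by
  by_contra ht
  have hp : 0 < |t| := abs_pos.2 ht
  obtain ⟨n, hn⟩ := exists_nat_gt (C / |t|)
  have h1 := h n
  rw [abs_mul, Nat.abs_cast] at h1
  rw [div_lt_iff₀ hp] at hn
  linarith

theorem le_one_of_pow_bdd (a C : ℝ) (h : ∀ n : ℕ, |a ^ n| ≤ C) : a ≤ 1 := by
  by_contra! ha
  obtain ⟨n, hn⟩ := pow_unbounded_of_one_lt C ha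
  have := (le_abs_self _).trans (h n)
  linarith

theorem upper_pow (p a b x y : ℝ) (n : ℕ) : ∃ b' x' y' : ℝ,
    (!![p, b, x; 0, a, y; 0, 0, 1] : Matrix (Fin 3) (Fin 3) ℝ) ^ n =
      !![p ^ n, b', x'; 0, a ^ n, y'; 0, 0, 1] := by
  induction n with
  | zero => exact ⟨0, 0, 0, by simp [Matrix.one_fin_three]⟩
  | succ n ih =>
    obtain ⟨b', x', y', h⟩ := ih
    refine ⟨p ^ n * b + b' * a, p ^ n * x + b' * y + x', a ^ n * y + y', ?_⟩
    rw [pow_succ, h, Matrix.mul_fin_three]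
    ext i j
    fin_cases i <;> fin_cases j <;> simp [pow_succ]

theorem unip_pow (b x y : ℝ) (n : ℕ) :
    (!![1, b, x; 0, 1, y; 0, 0, 1] : Matrix (Fin 3) (Fin 3) ℝ) ^ n =
      !![1, n * b, n * x + n * (n - 1) / 2 * (b * y); 0, 1, n * y; 0, 0, 1] := by
  induction n with
  | zero => simp [Matrix.one_fin_three]
  | succ n ih =>
    rw [pow_succ, ih, Matrix.mul_fin_three]
    ext i j
    fin_cases i <;> fin_cases j <;> simp <;> ring

/-- For `0 < r ≤ 2`, the only compact subgroup of `G_r` is the trivial subgroup. -/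
theorem compact_subgroup_Gr_eq_bot (r : ℝ) (hr0 : 0 < r) (hr2 : r ≤ 2)
    (H : Subgroup (Gr r)) (hH : IsCompact (H : Set (Gr r))) :
    H = ⊥ := by
  have hb : ∀ i j : Fin 3, ∃ C : ℝ, ∀ h ∈ H,
      |((h : GL (Fin 3) ℝ) : Matrix (Fin 3) (Fin 3) ℝ) i j| ≤ C := by
    intro i j
    have hc : Continuous (fun h : Gr r =>
        ((h : GL (Fin 3) ℝ) : Matrix (Fin 3) (Fin 3) ℝ) i j) :=
      (Units.continuous_val.comp continuous_subtype_val).matrix_elem i j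
    obtain ⟨C, hC⟩ := hH.exists_bound_of_continuousOn hc.continuousOn
    exact ⟨C, fun h hh => hC h hh⟩
  have hpow : ∀ i j : Fin 3, ∃ C : ℝ, ∀ h ∈ H, ∀ n : ℕ,
      |(((h : GL (Fin 3) ℝ) : Matrix (Fin 3) (Fin 3) ℝ) ^ n) i j| ≤ C := by
    intro i j
    obtain ⟨C, hC⟩ := hb i j
    refine ⟨C, fun h hh n => ?_⟩
    have := hC (h ^ n) (H.pow_mem hh n)
    simpa using this
  have hle : ∀ h ∈ H, ((h : GL (Fin 3) ℝ) : Matrix (Fin 3) (Fin 3) ℝ) 1 1 ≤ 1 := by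
    intro h hh
    obtain ⟨a, b, x, y, ha, hg⟩ := h.2
    obtain ⟨C, hC⟩ := hpow 1 1
    have h1 := hC h hh
    rw [hg] at h1 ⊢
    have : a ≤ 1 := by
      refine le_one_of_pow_bdd a C fun n => ?_
      obtain ⟨b', x', y', he⟩ := upper_pow (a ^ r) a b x y n
      have := h1 n
      rw [he] at this
      simpa using this
    simpa using this
  rw [Subgroup.eq_bot_iff_forall]
  intro g hgH
  obtain ⟨a, b, x, y, ha, hg⟩ := g.2
  obtain ⟨a', b', x', y', ha', hg'⟩ := (g⁻¹).2
  have h1 : a ≤ 1 := by simpa [hg] using hle g hgH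
  have h2 : a' ≤ 1 := by
    have := hle g⁻¹ (H.inv_mem hgH)
    rw [hg'] at this
    simpa using this
  have h3 : a * a' = 1 := by
    have h4 : ((g : GL (Fin 3) ℝ) : Matrix (Fin 3) (Fin 3) ℝ) *
        (((g⁻¹ : Gr r) : GL (Fin 3) ℝ) : Matrix (Fin 3) (Fin 3) ℝ) = 1 := by
      rw [← Units.val_mul, ← Subgroup.coe_mul, mul_inv_cancel]
      rfl
    rw [hg, hg', Matrix.mul_fin_three] at h4
    have := congrFun (congrFun h4 1) 1
    simpa using this
  have ha1 : a = 1 := by nlinarith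
  subst ha1
  rw [Real.one_rpow] at hg
  have key : ∀ i j : Fin 3, ∃ C : ℝ, ∀ n : ℕ,
      |(!![1, n * b, n * x + n * (n - 1) / 2 * (b * y); 0, 1, n * y; 0, 0, 1] :
        Matrix (Fin 3) (Fin 3) ℝ) i j| ≤ C := by
    intro i j
    obtain ⟨C, hC⟩ := hpow i j
    refine ⟨C, fun n => ?_⟩
    have := hC g hgH n
    rwa [hg, unip_pow] at this
  have hb0 : b = 0 := by
    obtain ⟨C, hC⟩ := key 0 1
    exact eq_zero_of_nat_mul_bdd b C fun n => by simpa using hC n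
  have hy0 : y = 0 := by
    obtain ⟨C, hC⟩ := key 1 2
    exact eq_zero_of_nat_mul_bdd y C fun n => by simpa using hC n
  subst hb0 hy0
  have hx0 : x = 0 := by
    obtain ⟨C, hC⟩ := key 0 2
    exact eq_zero_of_nat_mul_bdd x C fun n => by simpa using hC n
  subst hx0
  apply Subtype.ext
  apply Units.ext
  rw [hg]
  simp [Matrix.one_fin_three]
end

section
/- Let G be the minimal parabolic subgroup of SL(3, ℝ), i.e. the subgroup of GL(3, ℝ) (with the subspace topology) of upper triangular matrices with positive diagonal entries and determinant 1, and let μ be a left Haar measure on G. Then the left regular representation of G has no irreducible subrepresentation: there is no nonzero closed subspace V of L²(G, μ), invariant under all left translations ξ ↦ (t ↦ ξ(g⁻¹t)) (g ∈ G), such that the only closed left-translation-invariant subspaces of L²(G, μ) contained in V are {0} and V. -/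
open MeasureTheory Matrix

open Matrix

/-- The minimal parabolic subgroup of `SL(3, ℝ)`: upper triangular matrices with positive
diagonal entries and determinant 1, as a subgroup of `GL(3, ℝ)`. -/
noncomputable def ParabolicSL3 : Subgroup (GL (Fin 3) ℝ) where
  carrier := {g | (∀ i j : Fin 3, j < i → (g : Matrix (Fin 3) (Fin 3) ℝ) i j = 0) ∧
    (∀ i : Fin 3, 0 < (g : Matrix (Fin 3) (Fin 3) ℝ) i i) ∧
    (g : Matrix (Fin 3) (Fin 3) ℝ).det = 1}
  one_mem' := by
    refine ⟨?_, ?_, ?_⟩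
    · intro i j hij
      simp [Units.val_one, Matrix.one_apply, (ne_of_lt hij).symm]
    · intro i
      simp [Units.val_one, Matrix.one_apply]
    · simp [Units.val_one]
  mul_mem' := by
    rintro g g' ⟨hlow, hdiag, hdet⟩ ⟨hlow', hdiag', hdet'⟩
    have h10 := hlow 1 0 (by decide)
    have h20 := hlow 2 0 (by decide)
    have h21 := hlow 2 1 (by decide)
    have h10' := hlow' 1 0 (by decide)
    have h20' := hlow' 2 0 (by decide)
    have h21' := hlow' 2 1 (by decide)
    refine ⟨?_, ?_, ?_⟩
    · intro i j hij
      rw [Units.val_mul]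
      fin_cases i <;> fin_cases j <;>
        first
          | exact absurd hij (by decide)
          | simp [Matrix.mul_apply, Fin.sum_univ_three, h10, h20, h21, h10', h20', h21']
    · intro i
      rw [Units.val_mul]
      fin_cases i
      · simpa [Matrix.mul_apply, Fin.sum_univ_three, h10', h20'] using
          mul_pos (hdiag 0) (hdiag' 0)
      · simpa [Matrix.mul_apply, Fin.sum_univ_three, h10, h21'] using
          mul_pos (hdiag 1) (hdiag' 1)
      · simpa [Matrix.mul_apply, Fin.sum_univ_three, h20, h21] using
          mul_pos (hdiag 2) (hdiag' 2)
    · rw [Units.val_mul, Matrix.det_mul, hdet, hdet', mul_one]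
  inv_mem' := by
    rintro g ⟨hlow, hdiag, hdet⟩
    have h10 := hlow 1 0 (by decide)
    have h20 := hlow 2 0 (by decide)
    have h21 := hlow 2 1 (by decide)
    have ha := hdiag 0
    have hd := hdiag 1
    have hf := hdiag 2
    have ha0 : (g : Matrix (Fin 3) (Fin 3) ℝ) 0 0 ≠ 0 := ne_of_gt ha
    have hd0 : (g : Matrix (Fin 3) (Fin 3) ℝ) 1 1 ≠ 0 := ne_of_gt hd
    have hf0 : (g : Matrix (Fin 3) (Fin 3) ℝ) 2 2 ≠ 0 := ne_of_gt hf
    set A : Matrix (Fin 3) (Fin 3) ℝ := (g : Matrix (Fin 3) (Fin 3) ℝ) with hA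
    set N : Matrix (Fin 3) (Fin 3) ℝ :=
      !![(A 0 0)⁻¹, -(A 0 1) / (A 0 0 * A 1 1),
          (A 0 1 * A 1 2 - A 0 2 * A 1 1) / (A 0 0 * A 1 1 * A 2 2);
         0, (A 1 1)⁻¹, -(A 1 2) / (A 1 1 * A 2 2);
         0, 0, (A 2 2)⁻¹] with hNdef
    have hN : A * N = 1 := by
      ext i j
      fin_cases i <;> fin_cases j <;>
        · simp [hNdef, Matrix.mul_apply, Fin.sum_univ_three, Matrix.one_apply, Matrix.vecHead, Matrix.vecTail, h10, h20, h21]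
          try field_simp
          try ring
    have hinv : ((g⁻¹ : GL (Fin 3) ℝ) : Matrix (Fin 3) (Fin 3) ℝ) = N := by
      calc ((g⁻¹ : GL (Fin 3) ℝ) : Matrix (Fin 3) (Fin 3) ℝ)
          = ((g⁻¹ : GL (Fin 3) ℝ) : Matrix (Fin 3) (Fin 3) ℝ) * (A * N) := by
            rw [hN, mul_one]
        _ = (((g⁻¹ : GL (Fin 3) ℝ) : Matrix (Fin 3) (Fin 3) ℝ) * A) * N := by
            rw [mul_assoc]
        _ = N := by rw [hA, ← Units.val_mul, inv_mul_cancel, Units.val_one, one_mul]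
    refine ⟨?_, ?_, ?_⟩
    · intro i j hij
      rw [hinv]
      fin_cases i <;> fin_cases j <;>
        first
          | exact absurd hij (by decide)
          | simp [hNdef, Matrix.vecHead, Matrix.vecTail]
    · intro i
      rw [hinv]
      fin_cases i
      · simpa [hNdef, Matrix.vecHead, Matrix.vecTail] using inv_pos.2 ha
      · simpa [hNdef, Matrix.vecHead, Matrix.vecTail] using inv_pos.2 hd
      · simpa [hNdef, Matrix.vecHead, Matrix.vecTail] using inv_pos.2 hf
    · have hmul : ((g⁻¹ : GL (Fin 3) ℝ) : Matrix (Fin 3) (Fin 3) ℝ) * A = 1 := by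
        rw [hA, ← Units.val_mul, inv_mul_cancel, Units.val_one]
      have := congrArg Matrix.det hmul
      rw [Matrix.det_mul, hA] at this
      rw [hdet, mul_one] at this
      simpa using this

/-- A subspace of `L²(G, μ)` is invariant under the left regular representation if it is stable
under all left translations `ξ ↦ (t ↦ ξ(g⁻¹t))`. -/
def IsInvariantSubspace {G : Type*} [Group G] [TopologicalSpace G] [MeasurableSpace G]
    (μ : Measure G) (V : Submodule ℂ (Lp ℂ 2 μ)) : Prop :=
  ∀ (g : G) (ξ : Lp ℂ 2 μ), ξ ∈ V → ∀ η : Lp ℂ 2 μ,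
    (∀ᵐ t ∂μ, (η : G → ℂ) t = (ξ : G → ℂ) (g⁻¹ * t)) → η ∈ V

/-- An irreducible subrepresentation of the left regular representation: a nonzero closed
invariant subspace of `L²(G, μ)` whose only closed invariant subspaces are `⊥` and itself. -/
def IsIrreducibleSubspace {G : Type*} [Group G] [TopologicalSpace G] [MeasurableSpace G]
    (μ : Measure G) (V : Submodule ℂ (Lp ℂ 2 μ)) : Prop :=
  IsClosed (V : Set (Lp ℂ 2 μ)) ∧ IsInvariantSubspace μ V ∧ V ≠ ⊥ ∧
    ∀ W : Submodule ℂ (Lp ℂ 2 μ), IsClosed (W : Set (Lp ℂ 2 μ)) → IsInvariantSubspace μ W →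
      W ≤ V → W = ⊥ ∨ W = V

section part1
open MeasureTheory

theorem schur_sa {X ι : Type*} [NormedAddCommGroup X] [InnerProductSpace ℂ X] [CompleteSpace X]
    [Nontrivial X] (S : ι → X →L[ℂ] X)
    (hirr : ∀ W : Submodule ℂ X, IsClosed (W : Set X) → (∀ i, ∀ x ∈ W, S i x ∈ W) → W = ⊥ ∨ W = ⊤)
    (T : X →L[ℂ] X) (hT : IsSelfAdjoint T) (hc : ∀ i, Commute T (S i)) :
    ∃ r : ℝ, T = (r : ℂ) • (1 : X →L[ℂ] X) := by
  have key : ∀ m : ℝ, (∀ x ∈ spectrum ℝ T, x ≤ m) ∨ (∀ x ∈ spectrum ℝ T, m ≤ x) := by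
    intro m
    set f : ℝ → ℝ := fun x => max 0 (m - x) with hf
    set g : ℝ → ℝ := fun x => max 0 (x - m) with hg
    have hfc : Continuous f := by fun_prop
    have hgc : Continuous g := by fun_prop
    have hmul : cfc g T * cfc f T = 0 := by
      rw [← cfc_mul g f T hgc.continuousOn hfc.continuousOn]
      have : (fun x => g x * f x) = fun _ => 0 := by
        funext x
        simp only [hf, hg]
        rcases le_total x m with h | h
        · rw [max_eq_left (a := (0:ℝ)) (b := x - m) (by linarith)]; simp
        · rw [max_eq_left (a := (0:ℝ)) (b := m - x) (by linarith)]; simp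
      rw [this, cfc_const_zero]
    have zer : ∀ k : ℝ → ℝ, Continuous k → cfc k T = 0 → ∀ x ∈ spectrum ℝ T, k x = 0 := by
      intro k hk h0 x hx
      have h1 := cfc_map_spectrum (R := ℝ) k T hT hk.continuousOn
      rw [h0, spectrum.zero_eq] at h1
      have : k x ∈ k '' spectrum ℝ T := ⟨x, hx, rfl⟩
      rw [← h1] at this
      simpa using this
    have := hirr (LinearMap.ker (cfc g T : X →L[ℂ] X).toLinearMap) (ContinuousLinearMap.isClosed_ker _) (by
      intro i x hx
      have h1 := (hc i).cfc_real g
      have h2 := congrArg (fun L : X →L[ℂ] X => L x) h1.eq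
      change (cfc g T) (S i x) = S i (cfc g T x) at h2
      rw [LinearMap.mem_ker] at hx ⊢
      simp only [ContinuousLinearMap.coe_coe] at hx ⊢
      rw [h2, hx, map_zero])
    rcases this with h | h
    · right
      have : cfc f T = 0 := by
        ext x
        have h3 := congrArg (fun L : X →L[ℂ] X => L x) hmul
        change (cfc g T) (cfc f T x) = 0 at h3
        have : (cfc f T) x ∈ LinearMap.ker (cfc g T : X →L[ℂ] X).toLinearMap := by
          rw [LinearMap.mem_ker]; simpa using h3
        rw [h] at this
        simpa using this
      intro x hx
      have := zer f hfc this x hx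
      simp only [hf] at this
      have := le_max_right 0 (m - x)
      linarith
    · left
      have : cfc g T = 0 := by
        ext x
        have : x ∈ LinearMap.ker (cfc g T : X →L[ℂ] X).toLinearMap := by rw [h]; trivial
        rw [LinearMap.mem_ker] at this
        simpa using this
      intro x hx
      have := zer g hgc this x hx
      simp only [hg] at this
      have := le_max_right 0 (x - m)
      linarith
  obtain ⟨r, hr⟩ := ContinuousFunctionalCalculus.spectrum_nonempty (R := ℝ) T hT
  refine ⟨r, ?_⟩
  have hsub : ∀ x ∈ spectrum ℝ T, x = r := by
    intro x hx
    rcases key ((x + r) / 2) with h | h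
    · have := h x hx; have := h r hr; linarith
    · have := h x hx; have := h r hr; linarith
  calc T = cfc (id : ℝ → ℝ) T := (cfc_id ℝ T).symm
    _ = cfc (fun _ => r) T := cfc_congr (fun x hx => hsub x hx)
    _ = algebraMap ℝ _ r := cfc_const r T
    _ = (r : ℂ) • 1 := by
      rw [Algebra.algebraMap_eq_smul_one]
      ext x; simp

theorem schur {X ι : Type*} [NormedAddCommGroup X] [InnerProductSpace ℂ X] [CompleteSpace X]
    [Nontrivial X] (S : ι → X →L[ℂ] X) (hadj : ∀ i, ∃ j, star (S i) = S j)
    (hirr : ∀ W : Submodule ℂ X, IsClosed (W : Set X) → (∀ i, ∀ x ∈ W, S i x ∈ W) → W = ⊥ ∨ W = ⊤)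
    (T : X →L[ℂ] X) (hc : ∀ i, Commute T (S i)) :
    ∃ r : ℂ, T = r • (1 : X →L[ℂ] X) := by
  have hc' : ∀ i, Commute (star T) (S i) := by
    intro i
    obtain ⟨j, hj⟩ := hadj i
    have := (hc j).star_star
    rwa [← hj, star_star] at this
  obtain ⟨a, ha⟩ := schur_sa S hirr (T + star T) (IsSelfAdjoint.add_star_self T)
    (fun i => (hc i).add_left (hc' i))
  obtain ⟨b, hb⟩ := schur_sa S hirr (Complex.I • (T - star T)) (by
      rw [isSelfAdjoint_iff, star_smul, star_sub, star_star]
      simp only [Complex.star_def, Complex.conj_I]; module) (fun i => ((hc i).sub_left (hc' i)).smul_left _)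
  refine ⟨((a : ℂ) - Complex.I * b) / 2, ?_⟩
  have e : T = (1/2 : ℂ) • ((T + star T) - Complex.I • (Complex.I • (T - star T))) := by
    rw [smul_smul, Complex.I_mul_I]; module
  rw [e, ha, hb]; module
end part1

section part2
open MeasureTheory SchwartzMap FourierTransform
open scoped ContDiff InnerProductSpace

section four
variable {E F : Type*} [NormedAddCommGroup E] [InnerProductSpace ℝ E] [FiniteDimensional ℝ E]
  [MeasurableSpace E] [BorelSpace E]
  [NormedAddCommGroup F] [InnerProductSpace ℂ F] [CompleteSpace F]

theorem l1_uniq (φ : E → ℂ) (hφ : Integrable φ)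
    (h : ∀ v : E, 𝓕 φ v = 0) : φ =ᵐ[volume] 0 := by
  have : ∀ᵐ x, φ x = 0 := by
    apply ae_eq_zero_of_integral_contDiff_smul_eq_zero hφ.locallyIntegrable
    intro g hg hc
    have hc' : HasCompactSupport (fun x => (g x : ℂ)) := hc.comp_left (g := fun x : ℝ => (x:ℂ)) (by simp)
    have hg' : ContDiff ℝ ∞ (fun x => (g x : ℂ)) := Complex.ofRealCLM.contDiff.comp hg
    let ψ : 𝓢(E, ℂ) := hc'.toSchwartzMap hg'
    have e := VectorFourier.integral_fourierIntegral_smul_eq_flip (L := innerₗ E) (f := φ)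
      (g := (𝓕⁻ ψ : 𝓢(E, ℂ))) (μ := volume) (ν := volume) (e := Real.fourierChar)
      Real.continuous_fourierChar continuous_inner hφ (SchwartzMap.integrable _)
    have e1 : ∀ ξ, VectorFourier.fourierIntegral Real.fourierChar volume (innerₗ E) φ ξ = 0 := h
    have e2 : ∀ ξ, VectorFourier.fourierIntegral Real.fourierChar volume (innerₗ E).flip (𝓕⁻ ψ : 𝓢(E, ℂ)) ξ = g ξ := by
      intro ξ
      have : (innerₗ E).flip = innerₗ E := by
        ext x y; simp [real_inner_comm]
      rw [this]
      change 𝓕 ((𝓕⁻ ψ : 𝓢(E, ℂ)) : E → ℂ) ξ = _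
      rw [← SchwartzMap.fourier_coe]
      simp [ψ]
    simp only [e1, e2, zero_smul, integral_zero] at e
    rw [e]
    congr 1
    ext x
    simp [mul_comm]
  exact this

theorem four_pair (ψ : 𝓢(E, ℂ)) (f : Lp F 2 (volume : Measure E)) :
    ∫ x, ψ x • (𝓕 f : Lp F 2 (volume : Measure E)) x = ∫ x, (𝓕 ψ : 𝓢(E, ℂ)) x • f x := by
  have h := Lp.fourier_toTemperedDistribution_eq f
  have h2 := congrArg (fun D => D ψ) h
  simp only [Lp.toTemperedDistribution_apply] at h2
  rw [← h2, TemperedDistribution.fourier_apply, Lp.toTemperedDistribution_apply]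

theorem lp_locInt (f : Lp F 2 (volume : Measure E)) : LocallyIntegrable f volume :=
  (Lp.memLp f).locallyIntegrable (by norm_num)

theorem ae_eq_of_test (f f' : E → F) (hf : LocallyIntegrable f) (hf' : LocallyIntegrable f')
    (h : ∀ ψ : E → ℂ, ContDiff ℝ ∞ ψ → HasCompactSupport ψ → ∫ x, ψ x • f x = ∫ x, ψ x • f' x) :
    f =ᵐ[volume] f' := by
  letI : NormedSpace ℝ F := NormedSpace.complexToReal
  apply ae_eq_of_integral_contDiff_smul_eq hf hf'
  intro g hg hc
  have hc' : HasCompactSupport (fun x => (g x : ℂ)) := hc.comp_left (g := fun x : ℝ => (x:ℂ)) (by simp)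
  have hg' : ContDiff ℝ ∞ (fun x => (g x : ℂ)) := Complex.ofRealCLM.contDiff.comp hg
  simpa using h _ hg' hc'

theorem four_transl (f g : Lp F 2 (volume : Measure E)) (v₀ : E) (h : ∀ᵐ v, g v = f (v - v₀)) :
    ∀ᵐ ξ, (𝓕 g : Lp F 2 (volume : Measure E)) ξ
      = Complex.exp (-2 * Real.pi * Complex.I * ⟪v₀, ξ⟫_ℝ) • (𝓕 f : Lp F 2 (volume : Measure E)) ξ := by
  have hsm : ContDiff ℝ ∞ (fun ξ : E => Complex.exp (-2 * Real.pi * Complex.I * ⟪v₀, ξ⟫_ℝ)) := by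
    apply ContDiff.cexp
    apply ContDiff.mul contDiff_const
    exact Complex.ofRealCLM.contDiff.comp (contDiff_const.inner ℝ contDiff_id)
  have hn : ∀ ξ, ‖Complex.exp (-2 * Real.pi * Complex.I * ⟪v₀, ξ⟫_ℝ)‖ = 1 := by
    intro ξ
    rw [show (-2 * Real.pi * Complex.I * ⟪v₀, ξ⟫_ℝ : ℂ) = ((-2 * Real.pi * ⟪v₀, ξ⟫_ℝ : ℝ) : ℂ) * Complex.I by push_cast; ring]
    exact Complex.norm_exp_ofReal_mul_I _
  apply ae_eq_of_test _ _ (lp_locInt _)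
  · apply (lp_locInt (𝓕 f : Lp F 2 (volume : Measure E))).mono
    · exact hsm.continuous.aestronglyMeasurable.smul (Lp.aestronglyMeasurable _)
    · refine Filter.Eventually.of_forall fun ξ => ?_
      rw [norm_smul, hn, one_mul]
  intro ψ hψ hc
  let ψ1 : 𝓢(E, ℂ) := hc.toSchwartzMap hψ
  let ψ2 : 𝓢(E, ℂ) := (HasCompactSupport.toSchwartzMap (f := fun ξ => Complex.exp (-2 * Real.pi * Complex.I * ⟪v₀, ξ⟫_ℝ) * ψ ξ) hc.mul_left (hsm.mul hψ))
  have e1 := four_pair ψ1 g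
  have e2 := four_pair ψ2 f
  have hft : ∀ x, (𝓕 ψ1 : 𝓢(E, ℂ)) (x + v₀) = (𝓕 ψ2 : 𝓢(E, ℂ)) x := by
    intro x
    rw [SchwartzMap.fourier_coe, SchwartzMap.fourier_coe, Real.fourier_eq', Real.fourier_eq']
    refine integral_congr_ae (Filter.Eventually.of_forall fun ξ => ?_)
    simp only [ψ1, ψ2, HasCompactSupport.toSchwartzMap_toFun, smul_eq_mul]
    rw [← mul_assoc, ← Complex.exp_add, inner_add_right, real_inner_comm v₀ ξ]
    congr 2; push_cast; ring
  have e3 : ∫ x, (𝓕 ψ1 : 𝓢(E, ℂ)) x • g x = ∫ x, (𝓕 ψ2 : 𝓢(E, ℂ)) x • f x := by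
    calc _ = ∫ x, (𝓕 ψ1 : 𝓢(E, ℂ)) x • f (x - v₀) := by
            apply integral_congr_ae; filter_upwards [h] with x hx; rw [hx]
      _ = ∫ x, (fun x => (𝓕 ψ1 : 𝓢(E, ℂ)) (x + v₀) • f x) (x - v₀) := by
        simp only [sub_add_cancel]
      _ = ∫ x, (fun x => (𝓕 ψ1 : 𝓢(E, ℂ)) (x + v₀) • f x) x := integral_sub_right_eq_self (μ := volume) (fun x => (𝓕 ψ1 : 𝓢(E, ℂ)) (x + v₀) • f x) v₀
      _ = _ := by simp only [hft]
  rw [e3, ← e2] at e1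
  simp only [ψ1, ψ2, HasCompactSupport.toSchwartzMap_toFun] at e1
  rw [e1]
  congr 1; ext x
  rw [smul_smul, mul_comm]

theorem map_cv {k : ℝ} (hk : 0 < k) (B : E ≃L[ℝ] E) (hB : Measure.map B volume = ENNReal.ofReal k • (volume : Measure E))
     {F' : Type*} [NormedAddCommGroup F'] [NormedSpace ℂ F'] (φ : E → F') :
      ∫ x, φ (B x) = (k : ℂ) • ∫ x, φ x := by
    have := B.toHomeomorph.measurableEmbedding.integral_map (μ := volume) φ
    change ∫ y, φ y ∂(Measure.map B volume) = ∫ x, φ (B x) at this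
    rw [← this, hB, integral_smul_measure, ENNReal.toReal_ofReal hk.le]; simp

theorem four_lin (f g : Lp F 2 (volume : Measure E)) (A A' : E ≃L[ℝ] E) (hAA : ∀ v ξ, ⟪A v, ξ⟫_ℝ = ⟪v, A' ξ⟫_ℝ)
    (k : ℝ) (hk : 0 < k) (hA : Measure.map A volume = ENNReal.ofReal k • (volume : Measure E))
    (hA' : Measure.map A' volume = ENNReal.ofReal k • (volume : Measure E)) (κ : F →L[ℂ] F)
    (h : ∀ᵐ v, g v = κ (f (A.symm v))) :
    ∀ᵐ ξ, (𝓕 g : Lp F 2 (volume : Measure E)) ξ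
      = κ ((k⁻¹ : ℂ) • (𝓕 f : Lp F 2 (volume : Measure E)) (A' ξ)) := by
  
  have qmp : Measure.QuasiMeasurePreserving A' volume volume := by
    refine ⟨A'.continuous.measurable, ?_⟩
    rw [hA']; exact Measure.smul_absolutelyContinuous
  have kne : (k : ℂ) ≠ 0 := by exact_mod_cast hk.ne'
  have li0 : MemLp (fun ξ => (𝓕 f : Lp F 2 (volume : Measure E)) (A' ξ)) 2 volume := by
    have hm : MemLp (𝓕 f : Lp F 2 (volume : Measure E)) 2 (Measure.map A' volume) := by
      rw [hA']; exact (Lp.memLp _).smul_measure ENNReal.ofReal_ne_top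
    exact (hm.comp_of_map A'.continuous.aemeasurable)
  have li := li0.locallyIntegrable (by norm_num)
  apply ae_eq_of_test _ _ (lp_locInt _)
  · exact (κ.comp_memLp' (li0.const_smul (k⁻¹ : ℂ))).locallyIntegrable (by norm_num)
  intro ψ hψ hc
  let ψ1 : 𝓢(E, ℂ) := hc.toSchwartzMap hψ
  have hc2 : HasCompactSupport (fun ξ => ψ (A'.symm ξ)) := hc.comp_homeomorph A'.symm.toHomeomorph
  let ψ2 : 𝓢(E, ℂ) := (HasCompactSupport.toSchwartzMap hc2 (hψ.comp A'.symm.contDiff))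
  have e1 := four_pair ψ1 g
  have e2 := four_pair ψ2 f
  have hft : ∀ v, (𝓕 ψ1 : 𝓢(E, ℂ)) (A v) = (k : ℂ) * (𝓕 ψ2 : 𝓢(E, ℂ)) v := by
    intro v
    rw [SchwartzMap.fourier_coe, SchwartzMap.fourier_coe, Real.fourier_eq', Real.fourier_eq', ← smul_eq_mul]
    refine Eq.trans ?_ (map_cv hk A' hA' _)
    congr 1; ext ξ
    simp only [ψ1, ψ2, HasCompactSupport.toSchwartzMap_toFun, smul_eq_mul]
    rw [real_inner_comm, hAA, real_inner_comm]; simp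
  have intg : Integrable (fun v => (𝓕 ψ2 : 𝓢(E, ℂ)) v • f v) volume :=
    memLp_one_iff_integrable.1 (MemLp.smul (p := 2) (q := 2) (r := 1) (Lp.memLp f) (SchwartzMap.memLp _ 2 volume))
  have intg2 : Integrable (fun x => ψ x • (𝓕 f : Lp F 2 (volume : Measure E)) (A' x)) volume := by
    apply li.integrable_smul_left_of_hasCompactSupport hψ.continuous hc
  have e3 : ∫ x, (𝓕 ψ1 : 𝓢(E, ℂ)) x • g x = κ (∫ x, (𝓕 ψ2 : 𝓢(E, ℂ)) x • f x) := by
    calc _ = ∫ x, (𝓕 ψ1 : 𝓢(E, ℂ)) x • κ (f (A.symm x)) := by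
            apply integral_congr_ae; filter_upwards [h] with x hx; rw [hx]
      _ = (k⁻¹ : ℂ) • ∫ x, (fun x => (𝓕 ψ1 : 𝓢(E, ℂ)) x • κ (f (A.symm x))) (A x) := by
        rw [map_cv hk A hA (fun x => (𝓕 ψ1 : 𝓢(E, ℂ)) x • κ (f (A.symm x))), smul_smul, inv_mul_cancel₀ kne, one_smul]
      _ = ∫ x, κ ((𝓕 ψ2 : 𝓢(E, ℂ)) x • f x) := by
        rw [← integral_smul]
        congr 1; ext x
        simp only [hft, ContinuousLinearEquiv.symm_apply_apply, map_smul, smul_smul]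
        congr 1; field_simp
      _ = _ := ContinuousLinearMap.integral_comp_comm _ intg
  rw [e3, ← e2] at e1
  simp only [ψ1, ψ2, HasCompactSupport.toSchwartzMap_toFun] at e1
  rw [e1]
  have e4 : ∫ x, ψ (A'.symm x) • (𝓕 f : Lp F 2 (volume : Measure E)) x = (k⁻¹ : ℂ) • ∫ x, ψ x • (𝓕 f : Lp F 2 (volume : Measure E)) (A' x) := by
    have := map_cv hk A' hA' (fun x => ψ (A'.symm x) • (𝓕 f : Lp F 2 (volume : Measure E)) x)
    simp only [ContinuousLinearEquiv.symm_apply_apply] at this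
    rw [this, smul_smul, inv_mul_cancel₀ kne, one_smul]
  rw [e4, map_smul, ← ContinuousLinearMap.integral_comp_comm _ intg2, ← integral_smul]
  congr 1; ext x
  simp only [map_smul, smul_smul]
  rw [mul_comm]
end four
end part2

section part3
open MeasureTheory
open scoped ENNReal NNReal

theorem eLpNorm_two_sq {α F : Type*} [MeasurableSpace α] (μ : Measure α) [NormedAddCommGroup F] (f : α → F) :
    eLpNorm f 2 μ ^ 2 = ∫⁻ x, ‖f x‖ₑ ^ 2 ∂μ := by
  have := eLpNorm_nnreal_pow_eq_lintegral (μ := μ) (f := f) (p := 2) (by norm_num)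
  simpa using this

section slice
variable {α β : Type*} [MeasurableSpace α] [MeasurableSpace β] (μ : Measure α) (ν : Measure β)
  [SFinite μ] [SFinite ν] [TopologicalSpace.SeparableSpace (Lp ℂ 2 ν)]

theorem slice_exists (f : α × β → ℂ) (hf : MemLp f 2 (μ.prod ν)) :
    ∃ F : Lp (Lp ℂ 2 ν) 2 μ, (∀ᵐ a ∂μ, ∀ᵐ b ∂ν, F a b = f (a, b)) ∧
      ‖F‖ₑ ^ 2 = ∫⁻ p, ‖f p‖ₑ ^ 2 ∂(μ.prod ν) := by
  classical
  letI : MeasurableSpace (Lp ℂ 2 ν) := borel _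
  haveI : BorelSpace (Lp ℂ 2 ν) := ⟨rfl⟩
  haveI : SecondCountableTopology (Lp ℂ 2 ν) := UniformSpace.secondCountable_of_separable _
  set f' := hf.1.mk f with hf'
  have f'm : Measurable f' := hf.1.stronglyMeasurable_mk.measurable
  have hff : f =ᵐ[μ.prod ν] f' := hf.1.ae_eq_mk
  have sm : ∀ a, Measurable fun b => f' (a, b) := fun a => f'm.comp measurable_prodMk_left
  set S : Set α := {a | ∫⁻ b, ‖f' (a, b)‖ₑ ^ 2 ∂ν < ∞} with hS
  have Im : Measurable fun a => ∫⁻ b, ‖f' (a, b)‖ₑ ^ 2 ∂ν :=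
    Measurable.lintegral_prod_right' (f := fun p => ‖f' p‖ₑ ^ 2) (f'm.enorm.pow_const 2)
  have Sm : MeasurableSet S := measurableSet_lt Im measurable_const
  have mem : ∀ a, a ∈ S → MemLp (fun b => f' (a, b)) 2 ν := by
    intro a ha
    refine ⟨(sm a).aestronglyMeasurable, ?_⟩
    rw [hS, Set.mem_setOf_eq, ← eLpNorm_two_sq] at ha
    by_contra h
    rw [not_lt, top_le_iff] at h
    rw [h] at ha
    simp at ha
  set F0 : α → Lp ℂ 2 ν := fun a => if h : a ∈ S then (mem a h).toLp else 0 with hF0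
  have tot : ∫⁻ p, ‖f p‖ₑ ^ 2 ∂(μ.prod ν) = ∫⁻ a, ∫⁻ b, ‖f' (a, b)‖ₑ ^ 2 ∂ν ∂μ := by
    rw [← lintegral_prod (fun p => ‖f' p‖ₑ ^ 2) (f'm.enorm.pow_const 2).aemeasurable]
    apply lintegral_congr_ae
    filter_upwards [hff] with p hp
    rw [hp]
  have fin : ∫⁻ p, ‖f p‖ₑ ^ 2 ∂(μ.prod ν) < ∞ := by
    rw [← eLpNorm_two_sq]
    exact ENNReal.pow_lt_top hf.2
  have aeS : ∀ᵐ a ∂μ, a ∈ S := ae_lt_top Im (by rw [← tot]; exact fin.ne)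
  -- measurability
  have F0m : Measurable F0 := by
    let d := TopologicalSpace.denseSeq (Lp ℂ 2 ν)
    let Ψ : Lp ℂ 2 ν → ℕ → ℝ := fun x k => dist x (d k)
    have Ψc : Continuous Ψ := by
      apply continuous_pi; intro k; exact continuous_id.dist continuous_const
    have Ψi : Function.Injective Ψ := by
      intro x y hxy
      have hd := TopologicalSpace.denseRange_denseSeq (Lp ℂ 2 ν)
      have : (fun z => dist x z) = fun z => dist y z := by
        refine hd.equalizer (continuous_const.dist continuous_id) (continuous_const.dist continuous_id) ?_
        funext k
        exact congrFun hxy k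
      have := congrFun this y
      simpa using this
    have emb := Ψc.measurableEmbedding Ψi
    rw [← emb.measurable_comp_iff]
    apply measurable_pi_lambda
    intro k
    have dm : Measurable (d k) := (Lp.stronglyMeasurable (d k)).measurable
    have Jm : Measurable fun a => ∫⁻ b, ‖f' (a, b) - d k b‖ₑ ^ 2 ∂ν :=
      Measurable.lintegral_prod_right' (f := fun p => ‖f' p - d k p.2‖ₑ ^ 2)
        ((f'm.sub (dm.comp measurable_snd)).enorm.pow_const 2)
    have : (fun a => (Ψ ∘ F0) a k) = fun a => if a ∈ S then
        Real.sqrt ((∫⁻ b, ‖f' (a, b) - d k b‖ₑ ^ 2 ∂ν).toReal) else ‖d k‖ := by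
      funext a
      by_cases h : a ∈ S
      · simp only [Function.comp, h, if_true, Ψ, hF0, dif_pos]
        rw [← eLpNorm_two_sq, Lp.dist_def, ENNReal.toReal_pow, Real.sqrt_sq ENNReal.toReal_nonneg]
        congr 1
        apply eLpNorm_congr_ae
        filter_upwards [(mem a h).coeFn_toLp] with b hb
        simp [hb]
      · simp [Function.comp, h, Ψ, hF0]
    rw [this]
    exact Measurable.ite Sm Jm.ennreal_toReal.sqrt measurable_const
  have F0n : ∀ a ∈ S, ‖F0 a‖ₑ ^ 2 = ∫⁻ b, ‖f' (a, b)‖ₑ ^ 2 ∂ν := by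
    intro a ha
    simp only [hF0, ha, dif_pos]
    rw [Lp.enorm_toLp, eLpNorm_two_sq]
  have F0l : ∫⁻ a, ‖F0 a‖ₑ ^ 2 ∂μ = ∫⁻ p, ‖f p‖ₑ ^ 2 ∂(μ.prod ν) := by
    rw [tot]
    apply lintegral_congr_ae
    filter_upwards [aeS] with a ha using F0n a ha
  have F0L : MemLp F0 2 μ := by
    refine ⟨F0m.aestronglyMeasurable, ?_⟩
    rw [← F0l, ← eLpNorm_two_sq] at fin
    by_contra h
    rw [not_lt, top_le_iff] at h
    rw [h] at fin
    simp at fin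
  refine ⟨F0L.toLp, ?_, ?_⟩
  · have h2 := Measure.ae_ae_of_ae_prod hff
    filter_upwards [aeS, F0L.coeFn_toLp, h2] with a ha h1 h2
    rw [h1]
    simp only [hF0, ha, dif_pos]
    filter_upwards [(mem a ha).coeFn_toLp, h2] with b hb h2
    rw [hb, h2]
  · rw [Lp.enorm_toLp, eLpNorm_two_sq, F0l]

theorem slice_uniq (F F' : Lp (Lp ℂ 2 ν) 2 μ) (h : ∀ᵐ a ∂μ, ∀ᵐ b ∂ν, F a b = F' a b) : F = F' := by
  apply Lp.ext
  filter_upwards [h] with a ha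
  exact Lp.ext ha
end slice
end part3

section part4
open MeasureTheory Matrix

noncomputable abbrev PG := ParabolicSL3
abbrev E2 := EuclideanSpace ℝ (Fin 2)

namespace PSL

/-- matrix of an element -/
def mt (g : PG) : Matrix (Fin 3) (Fin 3) ℝ := ((g : GL (Fin 3) ℝ) : Matrix (Fin 3) (Fin 3) ℝ)

lemma mt_mul (g h : PG) : mt (g * h) = mt g * mt h := rfl
lemma mt_one : mt 1 = 1 := rfl
lemma mt_ext {g h : PG} (H : mt g = mt h) : g = h := Subtype.ext (Units.ext H)
lemma low (g : PG) : mt g 1 0 = 0 ∧ mt g 2 0 = 0 ∧ mt g 2 1 = 0 :=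
  ⟨g.2.1 1 0 (by decide), g.2.1 2 0 (by decide), g.2.1 2 1 (by decide)⟩
lemma dpos (g : PG) (i : Fin 3) : 0 < mt g i i := g.2.2.1 i
lemma mt_det (g : PG) : (mt g).det = 1 := g.2.2.2
lemma diag_prod (g : PG) : mt g 0 0 * mt g 1 1 * mt g 2 2 = 1 := by
  have := mt_det g
  rw [Matrix.det_fin_three] at this
  obtain ⟨h1, h2, h3⟩ := low g
  rw [h1, h2, h3] at this
  linarith

lemma mt_cont : Continuous mt := Units.continuous_val.comp continuous_subtype_val

@[fun_prop]
lemma ent_cont (i j : Fin 3) : Continuous fun g : PG => mt g i j :=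
  mt_cont.matrix_elem i j

lemma cont_of_ent {X : Type*} [TopologicalSpace X] {f : X → PG}
    (h : ∀ i j, Continuous fun x => mt (f x) i j) : Continuous f := by
  have hm : Continuous fun x => mt (f x) := continuous_matrix h
  apply Continuous.subtype_mk (f := fun x => ((f x : PG) : GL (Fin 3) ℝ)) ?_ (fun x => (f x).2)
  rw [Units.continuous_iff]
  refine ⟨hm, ?_⟩
  have : (fun x => ((((f x : PG) : GL (Fin 3) ℝ)⁻¹ : GL (Fin 3) ℝ) : Matrix (Fin 3) (Fin 3) ℝ)) =
      fun x => (mt (f x)).adjugate := by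
    funext x
    rw [Matrix.coe_units_inv, Matrix.inv_def]
    change Ring.inverse (mt (f x)).det • _ = _
    rw [mt_det]; simp; rfl
  rw [this]
  exact hm.matrix_adjugate

lemma closed_PG : IsClosed ((ParabolicSL3 : Subgroup (GL (Fin 3) ℝ)) : Set (GL (Fin 3) ℝ)) := by
  have e : ∀ i j, Continuous fun g : GL (Fin 3) ℝ => (g : Matrix (Fin 3) (Fin 3) ℝ) i j :=
    fun i j => Units.continuous_val.matrix_elem i j
  have : ((ParabolicSL3 : Subgroup (GL (Fin 3) ℝ)) : Set (GL (Fin 3) ℝ)) =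
      {g : GL (Fin 3) ℝ | (∀ i j : Fin 3, j < i → (g : Matrix (Fin 3) (Fin 3) ℝ) i j = 0) ∧
    (∀ i : Fin 3, 0 ≤ (g : Matrix (Fin 3) (Fin 3) ℝ) i i) ∧
    (g : Matrix (Fin 3) (Fin 3) ℝ).det = 1} := by
    ext g
    constructor
    · rintro ⟨h1, h2, h3⟩
      exact ⟨h1, fun i => (h2 i).le, h3⟩
    · rintro ⟨h1, h2, h3⟩
      refine ⟨h1, fun i => lt_of_le_of_ne (h2 i) ?_, h3⟩
      intro h
      rw [Matrix.det_fin_three, h1 1 0 (by decide), h1 2 0 (by decide), h1 2 1 (by decide)] at h3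
      fin_cases i <;> simp at h <;> simp [← h] at h3
  rw [this]
  simp only [Set.setOf_and, Set.setOf_forall]
  refine IsClosed.inter ?_ (IsClosed.inter ?_ ?_)
  · refine isClosed_iInter fun i => isClosed_iInter fun j => isClosed_iInter fun _ => ?_
    exact isClosed_eq (e i j) continuous_const
  · refine isClosed_iInter fun i => ?_
    exact isClosed_le continuous_const (e i i)
  · exact isClosed_eq Units.continuous_val.matrix_det continuous_const

instance : SecondCountableTopology (Matrix (Fin 3) (Fin 3) ℝ) :=
  inferInstanceAs (SecondCountableTopology (Fin 3 → Fin 3 → ℝ))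
instance : LocallyCompactSpace (Matrix (Fin 3) (Fin 3) ℝ) :=
  inferInstanceAs (LocallyCompactSpace (Fin 3 → Fin 3 → ℝ))
instance : SecondCountableTopology (Matrix (Fin 3) (Fin 3) ℝ)ᵐᵒᵖ :=
  MulOpposite.opHomeomorph.symm.secondCountableTopology
instance : SecondCountableTopology (GL (Fin 3) ℝ) :=
  Units.isEmbedding_embedProduct.secondCountableTopology
instance : LocallyCompactSpace PG := closed_PG.isClosedEmbedding_subtypeVal.locallyCompactSpace
instance : SecondCountableTopology PG := Topology.IsEmbedding.subtypeVal.secondCountableTopology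
instance : T2Space PG := inferInstance

/-- constructor -/
noncomputable def mk (a b x y z : ℝ) (ha : 0 < a) (hb : 0 < b) : PG :=
  ⟨Matrix.GeneralLinearGroup.mkOfDetNeZero !![a, x, y; 0, b, z; 0, 0, (a * b)⁻¹] (by
      rw [Matrix.det_fin_three]; simp [ha.ne', hb.ne']), by
    refine ⟨?_, ?_, ?_⟩
    · intro i j hij
      fin_cases i <;> fin_cases j <;>
        first
          | exact absurd hij (by decide)
          | simp [Matrix.GeneralLinearGroup.mkOfDetNeZero]
    · intro i
      fin_cases i <;> simp [Matrix.GeneralLinearGroup.mkOfDetNeZero, ha, hb]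
    · simp [Matrix.GeneralLinearGroup.mkOfDetNeZero, Matrix.det_fin_three]
      field_simp⟩

lemma mt_mk (a b x y z : ℝ) (ha : 0 < a) (hb : 0 < b) :
    mt (mk a b x y z ha hb) = !![a, x, y; 0, b, z; 0, 0, (a * b)⁻¹] := rfl

/-- the Levi-type subgroup -/
def Hs : Subgroup PG where
  carrier := {g | mt g 0 2 = 0 ∧ mt g 1 2 = 0}
  one_mem' := by simp [mt_one]
  mul_mem' := by
    rintro g h ⟨h1, h2⟩ ⟨h3, h4⟩
    have := low g
    simp [mt_mul, Matrix.mul_apply, Fin.sum_univ_three, h1, h2, h3, h4]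
  inv_mem' := by
    rintro g ⟨h1, h2⟩
    have e : mt g⁻¹ * mt g = 1 := by rw [← mt_mul, inv_mul_cancel, mt_one]
    have e1 := congrFun (congrFun e 0) 2
    have e2 := congrFun (congrFun e 1) 2
    simp [Matrix.mul_apply, Fin.sum_univ_three, h1, h2, (dpos g 2).ne'] at e1 e2
    exact ⟨e1, e2⟩

lemma closed_Hs : IsClosed (Hs : Set PG) :=
  (isClosed_eq (ent_cont 0 2) continuous_const).inter (isClosed_eq (ent_cont 1 2) continuous_const)

instance : LocallyCompactSpace Hs := closed_Hs.isClosedEmbedding_subtypeVal.locallyCompactSpace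
instance : SecondCountableTopology Hs := Topology.IsEmbedding.subtypeVal.secondCountableTopology

/-- matrix of an element of `Hs` -/
def mh (h : Hs) : Matrix (Fin 3) (Fin 3) ℝ := mt h.1
lemma mh_mul (g h : Hs) : mh (g * h) = mh g * mh h := rfl
lemma mh_one : mh 1 = 1 := rfl
lemma mh_zero (h : Hs) : mh h 1 0 = 0 ∧ mh h 2 0 = 0 ∧ mh h 2 1 = 0 ∧ mh h 0 2 = 0 ∧ mh h 1 2 = 0 :=
  ⟨(low h.1).1, (low h.1).2.1, (low h.1).2.2, h.2.1, h.2.2⟩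
lemma hpos (h : Hs) (i : Fin 3) : 0 < mh h i i := dpos h.1 i
@[fun_prop]
lemma enth_cont (i j : Fin 3) : Continuous fun g : Hs => mh g i j :=
  (ent_cont i j).comp continuous_subtype_val

lemma mh_ext {g h : Hs} (h00 : mh g 0 0 = mh h 0 0) (h01 : mh g 0 1 = mh h 0 1)
   (h11 : mh g 1 1 = mh h 1 1) (h22 : mh g 2 2 = mh h 2 2) : g = h := by
  apply Subtype.ext; apply mt_ext
  obtain ⟨a1, a2, a3, a4, a5⟩ := mh_zero g
  obtain ⟨b1, b2, b3, b4, b5⟩ := mh_zero h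
  change mh g = mh h
  ext i j
  fin_cases i <;> fin_cases j <;> simp <;> linarith

lemma mh_mul00 (g h : Hs) : mh (g * h) 0 0 = mh g 0 0 * mh h 0 0 := by
  obtain ⟨b1, b2, b3, b4, b5⟩ := mh_zero h
  simp [mh_mul, Matrix.mul_apply, Fin.sum_univ_three, b1, b2]
lemma mh_mul01 (g h : Hs) : mh (g * h) 0 1 = mh g 0 0 * mh h 0 1 + mh g 0 1 * mh h 1 1 := by
  obtain ⟨b1, b2, b3, b4, b5⟩ := mh_zero h
  simp [mh_mul, Matrix.mul_apply, Fin.sum_univ_three, b3]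
lemma mh_mul11 (g h : Hs) : mh (g * h) 1 1 = mh g 1 1 * mh h 1 1 := by
  obtain ⟨b1, b2, b3, b4, b5⟩ := mh_zero h
  obtain ⟨a1, a2, a3, a4, a5⟩ := mh_zero g
  simp [mh_mul, Matrix.mul_apply, Fin.sum_univ_three, b3, a1]
lemma mh_mul22 (g h : Hs) : mh (g * h) 2 2 = mh g 2 2 * mh h 2 2 := by
  obtain ⟨b1, b2, b3, b4, b5⟩ := mh_zero h
  obtain ⟨a1, a2, a3, a4, a5⟩ := mh_zero g
  simp [mh_mul, Matrix.mul_apply, Fin.sum_univ_three, b4, a2, a3]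
lemma mh_prod (h : Hs) : mh h 0 0 * mh h 1 1 * mh h 2 2 = 1 := diag_prod h.1

/-- unipotent abelian part -/
noncomputable def bb (v : E2) : PG := mk 1 1 0 (v 0) (v 1) one_pos one_pos
lemma mt_bb (v : E2) : mt (bb v) = !![1, 0, v 0; 0, 1, v 1; 0, 0, 1] := by
  rw [bb, mt_mk]; simp
lemma bb_add (v w : E2) : bb (v + w) = bb v * bb w := by
  apply mt_ext
  rw [mt_mul, mt_bb, mt_bb, mt_bb]
  ext i j
  fin_cases i <;> fin_cases j <;> simp [Matrix.mul_apply, Fin.sum_univ_three, add_comm]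
lemma bb_zero : bb 0 = 1 := by
  apply mt_ext
  rw [mt_bb, mt_one]
  ext i j
  fin_cases i <;> fin_cases j <;> simp 
lemma bb_neg (v : E2) : bb (-v) = (bb v)⁻¹ := by
  rw [eq_inv_iff_mul_eq_one, ← bb_add]; simp [bb_zero]
lemma bb_cont : Continuous bb := by
  apply cont_of_ent
  intro i j
  simp only [mt_bb]
  fin_cases i <;> fin_cases j <;> simp <;> fun_prop

/-- action matrix -/
noncomputable def sM (h : Hs) : Matrix (Fin 2) (Fin 2) ℝ :=
  (mh h 2 2)⁻¹ • !![mh h 0 0, mh h 0 1; 0, mh h 1 1]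
lemma sM_mul (g h : Hs) : sM (g * h) = sM g * sM h := by
  have := (hpos g 2).ne'
  have := (hpos h 2).ne'
  ext i j
  fin_cases i <;> fin_cases j <;>
   simp [sM, Matrix.mul_apply, mh_mul00, mh_mul01, mh_mul11, mh_mul22] <;> field_simp
lemma sM_one : sM 1 = 1 := by
  ext i j
  fin_cases i <;> fin_cases j <;> simp [sM, mh_one]
lemma sM_det (h : Hs) : (sM h).det = ((mh h 2 2)⁻¹) ^ 3 := by
  have h1 := mh_prod h
  have h2 := (hpos h 2).ne'
  simp [sM, Matrix.det_fin_two, Matrix.det_smul]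
  field_simp
  linarith

noncomputable def lin (M : Matrix (Fin 2) (Fin 2) ℝ) : E2 →L[ℝ] E2 := Matrix.toEuclideanCLM (𝕜 := ℝ) M
lemma lin_mul (M N : Matrix (Fin 2) (Fin 2) ℝ) (v : E2) : lin (M * N) v = lin M (lin N v) := by
  simp [lin]
lemma lin_one (v : E2) : lin 1 v = v := by simp [lin]
lemma lin_apply (M : Matrix (Fin 2) (Fin 2) ℝ) (v : E2) (i : Fin 2) :
    lin M v i = M i 0 * v 0 + M i 1 * v 1 := by
  rw [lin, Matrix.ofLp_toEuclideanCLM]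
  simp [Matrix.mulVec, dotProduct, Fin.sum_univ_two]

lemma lin_map (M : Matrix (Fin 2) (Fin 2) ℝ) (hM : 0 < M.det) :
    Measure.map (lin M) volume = ENNReal.ofReal (M.det)⁻¹ • (volume : Measure E2) := by
  have hd : LinearMap.det (lin M : E2 →ₗ[ℝ] E2) = M.det := by
    rw [lin, Matrix.coe_toEuclideanCLM_eq_toEuclideanLin, Matrix.toEuclideanLin_eq_toLin_orthonormal, LinearMap.det_toLin]
  have := Measure.map_linearMap_addHaar_eq_smul_addHaar (volume : Measure E2) (f := (lin M : E2 →ₗ[ℝ] E2)) (by rw [hd]; exact hM.ne')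
  rw [hd, abs_of_pos (inv_pos.2 hM)] at this
  exact this

noncomputable def linE (M N : Matrix (Fin 2) (Fin 2) ℝ) (h : M * N = 1) : E2 ≃L[ℝ] E2 :=
  ContinuousLinearEquiv.equivOfInverse (lin M) (lin N)
   (fun v => by rw [← lin_mul, mul_eq_one_comm.1 h, lin_one]) (fun v => by rw [← lin_mul, h, lin_one])

noncomputable def sg (h : Hs) : E2 ≃L[ℝ] E2 := linE (sM h) (sM h⁻¹) (by rw [← sM_mul, mul_inv_cancel, sM_one])
noncomputable def st (h : Hs) : E2 ≃L[ℝ] E2 := linE (sM h)ᵀ (sM h⁻¹)ᵀ (by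
  rw [← Matrix.transpose_mul, ← sM_mul, inv_mul_cancel, sM_one, Matrix.transpose_one])
lemma sg_apply (h : Hs) (v : E2) : sg h v = lin (sM h) v := rfl
lemma st_apply (h : Hs) (v : E2) : st h v = lin (sM h)ᵀ v := rfl
lemma sg_symm (h : Hs) (v : E2) : (sg h).symm v = lin (sM h⁻¹) v := rfl
lemma sg_symm' (h : Hs) (v : E2) : (sg h).symm v = sg h⁻¹ v := rfl
lemma st_adj (h : Hs) (v w : E2) : inner ℝ (sg h v) w = inner ℝ v (st h w) := by
  simp only [EuclideanSpace.inner_eq_star_dotProduct, dotProduct, Fin.sum_univ_two, sg_apply, st_apply, lin_apply]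
  simp [lin_apply]
  ring
lemma st_mul (g h : Hs) (v : E2) : st (g * h) v = st h (st g v) := by
  simp only [st_apply, sM_mul, Matrix.transpose_mul, lin_mul]
lemma st0 (h : Hs) (v : E2) : st h v 0 = (mh h 2 2)⁻¹ * (mh h 0 0 * v 0) := by
  simp [st_apply, lin_apply, sM, mul_assoc]
lemma st1 (h : Hs) (v : E2) : st h v 1 = (mh h 2 2)⁻¹ * (mh h 0 1 * v 0 + mh h 1 1 * v 1) := by
  simp [st_apply, lin_apply, sM, mul_assoc, mul_add]

lemma sg_map (h : Hs) : Measure.map (sg h) volume = ENNReal.ofReal (mh h 2 2 ^ 3) • (volume : Measure E2) := by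
  have := lin_map (sM h) (by rw [sM_det]; exact pow_pos (inv_pos.2 (hpos h 2)) 3)
  rw [sM_det] at this
  rw [show ⇑(sg h) = ⇑(lin (sM h)) from rfl]
  simpa using this
lemma st_map (h : Hs) : Measure.map (st h) volume = ENNReal.ofReal (mh h 2 2 ^ 3) • (volume : Measure E2) := by
  have := lin_map (sM h)ᵀ (by rw [Matrix.det_transpose, sM_det]; exact pow_pos (inv_pos.2 (hpos h 2)) 3)
  rw [Matrix.det_transpose, sM_det] at this
  rw [show ⇑(st h) = ⇑(lin (sM h)ᵀ) from rfl]
  simpa using this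

lemma conj_bb (h : Hs) (v : E2) : (h : PG) * bb v = bb (sg h v) * h := by
  apply mt_ext
  obtain ⟨a1, a2, a3, a4, a5⟩ := mh_zero h
  have h2 := (hpos h 2).ne'
  have : mt (h : PG) = mh h := rfl
  rw [mt_mul, mt_mul, mt_bb, mt_bb, this]
  ext i j
  fin_cases i <;> fin_cases j <;>
    simp [Matrix.mul_apply, Fin.sum_univ_three, a1, a2, a3, a4, a5, sg_apply, lin_apply, sM] <;> field_simp

noncomputable def vOf (g : PG) : E2 := !₂[mt g 0 2 / mt g 2 2, mt g 1 2 / mt g 2 2]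
noncomputable def hOf (g : PG) : Hs := ⟨bb (-vOf g) * g, by
  have h2 := (dpos g 2).ne'
  constructor <;> rw [mt_mul, mt_bb] <;> simp [Matrix.mul_apply, Fin.sum_univ_three, vOf] <;> field_simp <;> ring⟩

noncomputable def mm : E2 × Hs ≃ₜ PG where
  toFun p := bb p.1 * p.2
  invFun g := (vOf g, hOf g)
  left_inv := by
    rintro ⟨v, h⟩
    obtain ⟨a1, a2, a3, a4, a5⟩ := mh_zero h
    have h2 := (hpos h 2).ne'
    have : mt (h : PG) = mh h := rfl
    have hv : vOf (bb v * h) = v := by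
      ext i
      fin_cases i <;> simp [vOf, mt_mul, mt_bb, Matrix.mul_apply, Fin.sum_univ_three, this, a1, a2, a3, a4, a5] <;> field_simp
    refine Prod.ext hv (Subtype.ext ?_)
    simp only [hOf, hv, bb_neg]
    simp
  right_inv g := by simp [hOf, bb_neg]
  continuous_toFun := (bb_cont.comp continuous_fst).mul (continuous_subtype_val.comp continuous_snd)
  continuous_invFun := by
    have hv : Continuous vOf := by
      apply (PiLp.continuous_toLp 2 _).comp
      apply continuous_pi
      intro i
      fin_cases i <;> simp <;> exact (ent_cont _ _).div₀ (ent_cont _ _) (fun g => (dpos g 2).ne')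
    exact hv.prodMk (((bb_cont.comp hv.neg).mul continuous_id).subtype_mk _)
lemma mm_apply (v : E2) (h : Hs) : mm (v, h) = bb v * h := rfl

/-- special elements -/
noncomputable def hh (w : ℝ) : Hs := ⟨mk 2 (1/4) (7/4 * w) 0 0 (by norm_num) (by norm_num), by
  constructor <;> rw [mt_mk] <;> simp⟩
lemma hh00 (w : ℝ) : mh (hh w) 0 0 = 2 := by simp [mh, hh, mt_mk]
lemma hh01 (w : ℝ) : mh (hh w) 0 1 = 7/4 * w := by simp [mh, hh, mt_mk]
lemma hh11 (w : ℝ) : mh (hh w) 1 1 = 1/4 := by simp [mh, hh, mt_mk]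
lemma hh22 (w : ℝ) : mh (hh w) 2 2 = 2 := by simp [mh, hh, mt_mk]; norm_num
lemma hh_cont : Continuous hh := by
  refine Continuous.subtype_mk (cont_of_ent fun i j => ?_) _
  simp only [mt_mk]
  fin_cases i <;> fin_cases j <;> simp <;> fun_prop

noncomputable def uu (ξ : E2) : ℝ := ξ 1 / ξ 0

lemma hh_comm (h : Hs) (ξ : E2) (hξ : ξ 0 ≠ 0) : h * hh (uu (st h ξ)) = hh (uu ξ) * h := by
  have h2 := (hpos h 2).ne'
  have h0 := (hpos h 0).ne'
  apply mh_ext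
  · simp [mh_mul00, hh00]; ring
  · simp only [mh_mul01, hh01, hh11, hh00, uu, st0, st1]
    field_simp
    ring
  · simp [mh_mul11, hh11]; ring
  · simp [mh_mul22, hh22]; ring

/-- shear -/
noncomputable def shM (d : ℝ) : Matrix (Fin 2) (Fin 2) ℝ := !![1, 0; 7/8 * d, 1]
lemma sh_eq (d : ℝ) (ξ : E2) (hξ : ξ 0 ≠ 0) : st (hh (uu ξ + d)) ξ = lin (shM d) ξ := by
  ext i
  fin_cases i
  · simp [st0, hh00, hh22, lin_apply, shM]
  · simp [st1, hh00, hh22, hh01, hh11, lin_apply, shM, uu]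
    field_simp
    ring
lemma sh_mp (d : ℝ) : MeasurePreserving (lin (shM d)) (volume : Measure E2) volume := by
  refine ⟨(lin (shM d)).continuous.measurable, ?_⟩
  rw [lin_map _ (by simp [shM, Matrix.det_fin_two])]
  simp [shM, Matrix.det_fin_two]
lemma sh_zero (v : E2) : lin (shM 0) v = v := by
  ext i
  fin_cases i <;> simp [lin_apply, shM]
lemma sh_cont : Continuous fun p : ℝ × E2 => lin (shM p.1) p.2 := by
  rw [← (PiLp.homeomorph 2 _).comp_continuous_iff]
  apply continuous_pi
  intro i
  change Continuous fun p : ℝ × E2 => lin (shM p.1) p.2 i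
  simp only [lin_apply]
  fin_cases i <;> simp [shM] <;> fun_prop
lemma ae_ne : ∀ᵐ ξ : E2, ξ 0 ≠ 0 := by
  have := Measure.addHaar_submodule (volume : Measure E2) (LinearMap.ker ((EuclideanSpace.proj (0 : Fin 2) : E2 →L[ℝ] ℝ).toLinearMap)) (by
    intro h
    have : (EuclideanSpace.single (0 : Fin 2) (1:ℝ)) ∈ LinearMap.ker ((EuclideanSpace.proj (0 : Fin 2) : E2 →L[ℝ] ℝ).toLinearMap) := by rw [h]; trivial
    rw [LinearMap.mem_ker] at this
    simp at this)
  rw [ae_iff]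
  convert this using 2
  ext ξ
  simp
lemma uu_meas : Measurable uu := by
  have h1 : Measurable fun ξ : E2 => ξ 1 := (by fun_prop : Continuous fun ξ : E2 => ξ 1).measurable
  have h0 : Measurable fun ξ : E2 => ξ 0 := (by fun_prop : Continuous fun ξ : E2 => ξ 0).measurable
  exact h1.div h0
end PSL
end part4

section part5
open MeasureTheory Matrix
open scoped ENNReal
namespace PSL
section haar
variable [MeasurableSpace PG] [BorelSpace PG]

/-- weight measure -/
noncomputable def wt (ν : Measure Hs) : Measure Hs := ν.withDensity fun h => ENNReal.ofReal (mh h 2 2 ^ 3)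

lemma wt_meas : Measurable fun h : Hs => ENNReal.ofReal (mh h 2 2 ^ 3) :=
  (Continuous.measurable (by fun_prop : Continuous fun h : Hs => mh h 2 2 ^ 3)).ennreal_ofReal

noncomputable def pm (ν : Measure Hs) : Measure PG := Measure.map mm ((volume : Measure E2).prod (wt ν))

lemma wt_translate (ν : Measure Hs) [ν.IsHaarMeasure] (h0 : Hs) :
    Measure.map (h0 * ·) (wt ν) = ENNReal.ofReal ((mh h0 2 2 ^ 3)⁻¹) • wt ν := by
  ext s hs
  have hm : Measurable (fun h : Hs => h0 * h) := measurable_const_mul h0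
  rw [Measure.map_apply hm hs, Measure.smul_apply, wt, withDensity_apply _ hs, withDensity_apply _ (hm hs),
    ← lintegral_indicator hs, ← lintegral_indicator (hm hs), smul_eq_mul,
    ← lintegral_const_mul _ (wt_meas.indicator hs)]
  rw [← lintegral_mul_left_eq_self _ h0⁻¹ ]
  congr 1
  ext h
  by_cases hh : h ∈ s
  · rw [Set.indicator_of_mem (by simpa using hh), Set.indicator_of_mem hh, ← ENNReal.ofReal_mul (by have := hpos h0 2; positivity)]
    congr 1
    have : mh h0 2 2 * mh h0⁻¹ 2 2 = 1 := by rw [← mh_mul22]; simp [mh_one]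
    have h2 := (hpos h0 2).ne'
    rw [mh_mul22, mul_pow, eq_inv_of_mul_eq_one_right this, inv_pow]
  · rw [Set.indicator_of_notMem (by simpa using hh), Set.indicator_of_notMem hh, mul_zero]

instance wt_sf (ν : Measure Hs) [SFinite ν] : SFinite (wt ν) := by unfold wt; infer_instance

lemma pm_haar (ν : Measure Hs) [ν.IsHaarMeasure] : (pm ν).IsHaarMeasure := by
  haveI : IsLocallyFiniteMeasure (wt ν) :=
    IsLocallyFiniteMeasure.withDensity_ofReal (by fun_prop)
  haveI : (wt ν).IsOpenPosMeasure := by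
    apply (withDensity_absolutelyContinuous' wt_meas.aemeasurable ?_).isOpenPosMeasure
    exact Filter.Eventually.of_forall fun h => by
      have := hpos h 2
      simp only [ne_eq, ENNReal.ofReal_eq_zero, not_le]; positivity
  have mmm : Measurable mm := mm.continuous.measurable
  have i1 : IsFiniteMeasureOnCompacts (pm ν) := by
    constructor
    intro K hK
    rw [pm, Measure.map_apply_of_aemeasurable mmm.aemeasurable hK.measurableSet]
    exact ((mm.isCompact_preimage).2 hK).measure_lt_top
  have i2 : (pm ν).IsOpenPosMeasure := mm.continuous.isOpenPosMeasure_map mm.surjective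
  have hb : ∀ v : E2, Measure.map (bb v * ·) (pm ν) = pm ν := by
    intro v
    have e : (bb v * ·) ∘ mm = mm ∘ Prod.map (v + ·) id := by
      funext ⟨w, h⟩
      simp [mm_apply, bb_add, mul_assoc]
    rw [pm, Measure.map_map (measurable_const_mul _) mmm, e, ← Measure.map_map mmm (by fun_prop),
      ← Measure.map_prod_map _ _ (measurable_const_add v) measurable_id, Measure.map_id, map_add_left_eq_self]
  have hh : ∀ h0 : Hs, Measure.map ((h0 : PG) * ·) (pm ν) = pm ν := by
    intro h0
    have e : ((h0 : PG) * ·) ∘ mm = mm ∘ Prod.map (sg h0) (h0 * ·) := by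
      funext ⟨w, h⟩
      simp [mm_apply, ← mul_assoc, conj_bb]
    have c0 := hpos h0 2
    rw [pm, Measure.map_map (measurable_const_mul _) mmm, e, ← Measure.map_map mmm
      ((sg h0).continuous.measurable.prodMap (measurable_const_mul h0)),
      ← Measure.map_prod_map _ _ (sg h0).continuous.measurable (measurable_const_mul h0), sg_map, wt_translate,
      Measure.prod_smul_left, Measure.prod_smul_right, smul_smul, ← ENNReal.ofReal_mul (by positivity),
      mul_inv_cancel₀ (by positivity)]
    simp
  have i3 : (pm ν).IsMulLeftInvariant := by
    constructor
    intro g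
    obtain ⟨⟨v, h⟩, rfl⟩ := mm.surjective g
    have : ((mm (v, h)) * ·) = (bb v * ·) ∘ ((h : PG) * ·) := by
      funext t; simp [mm_apply, mul_assoc]
    rw [this, ← Measure.map_map (measurable_const_mul _) (measurable_const_mul _), hh, hb]
  exact { }

theorem exists_nu (μ : Measure PG) [μ.IsHaarMeasure] : ∃ ν : Measure Hs, ν.IsHaarMeasure ∧ μ = pm ν := by
  haveI := pm_haar (Measure.haar : Measure Hs)
  have e := Measure.isMulLeftInvariant_eq_smul μ (pm (Measure.haar : Measure Hs))
  set k := Measure.haarScalarFactor μ (pm (Measure.haar : Measure Hs)) with hk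
  have kp : 0 < k := Measure.haarScalarFactor_pos_of_isHaarMeasure _ _
  refine ⟨(k : ℝ≥0∞) • Measure.haar, Measure.IsHaarMeasure.smul _ (by simpa using kp.ne') (by simp), ?_⟩
  rw [e, pm, pm, wt, wt, withDensity_smul_measure, Measure.prod_smul_right, Measure.map_smul]
  rfl
end haar
end PSL
end part5

section part6
open MeasureTheory Matrix
open scoped ENNReal FourierTransform
namespace PSL

section lam
variable {K : Type*} [Group K] [MeasurableSpace K] [MeasurableMul K] (μ : Measure K) [μ.IsMulLeftInvariant]

/-- left regular representation -/
noncomputable def lam (g : K) : Lp ℂ 2 μ →ₗᵢ[ℂ] Lp ℂ 2 μ :=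
  Lp.compMeasurePreservingₗᵢ ℂ (g⁻¹ * ·) (measurePreserving_mul_left μ g⁻¹)
lemma lam_ae (g : K) (f : Lp ℂ 2 μ) : ∀ᵐ t ∂μ, lam μ g f t = f (g⁻¹ * t) :=
  Lp.coeFn_compMeasurePreserving f (measurePreserving_mul_left μ g⁻¹)
lemma lam_mul (g h : K) (f : Lp ℂ 2 μ) : lam μ (g * h) f = lam μ g (lam μ h f) := by
  apply Lp.ext
  filter_upwards [lam_ae μ (g * h) f, lam_ae μ g (lam μ h f),
    (measurePreserving_mul_left μ g⁻¹).quasiMeasurePreserving.ae (lam_ae μ h f)] with t h1 h2 h3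
  rw [h1, h2, h3, _root_.mul_inv_rev, mul_assoc]
lemma lam_one (f : Lp ℂ 2 μ) : lam μ 1 f = f := by
  apply Lp.ext
  filter_upwards [lam_ae μ 1 f] with t h1
  rw [h1]; simp
end lam

section wts
/-- weight -/
noncomputable def ww (h : Hs) : ℝ := Real.sqrt (mh h 2 2 ^ 3)
lemma ww_pos (h : Hs) : 0 < ww h := Real.sqrt_pos.2 (pow_pos (hpos h 2) 3)
lemma ww_mul (g h : Hs) : ww (g * h) = ww g * ww h := by
  rw [ww, mh_mul22, mul_pow, Real.sqrt_mul (pow_pos (hpos g 2) 3).le]; rfl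
lemma ww_cont : Continuous ww := by unfold ww; fun_prop
lemma ww_sq (h : Hs) : ‖(ww h : ℂ)‖ₑ ^ 2 = ENNReal.ofReal (mh h 2 2 ^ 3) := by
  rw [← ofReal_norm, Complex.norm_real, Real.norm_of_nonneg (ww_pos h).le, ← ENNReal.ofReal_pow (ww_pos h).le, ww,
    Real.sq_sqrt (pow_pos (hpos h 2) 3).le]

noncomputable def rr (h : Hs) : ℂ := (ww h : ℂ) * ((mh h 2 2 ^ 3 : ℝ) : ℂ)⁻¹
lemma rr_ne (h : Hs) : rr h ≠ 0 := by
  have h1 := (ww_pos h).ne'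
  have h2 := (hpos h 2).ne'
  unfold rr
  exact mul_ne_zero (by exact_mod_cast h1) (inv_ne_zero (by exact_mod_cast pow_ne_zero 3 h2))

end wts

section phi
variable [MeasurableSpace PG] [BorelSpace PG] (ν : Measure Hs) [ν.IsHaarMeasure]

instance sepL2 : SecondCountableTopology (Lp ℂ 2 ν) :=
  haveI : Fact ((2:ℝ≥0∞) ≠ ∞) := ⟨by norm_num⟩
  inferInstance
instance sepL2' : TopologicalSpace.SeparableSpace (Lp ℂ 2 ν) := inferInstance

lemma lam_cont : Continuous fun p : Hs × Lp ℂ 2 ν => lam ν p.1 p.2 := by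
  haveI : Fact ((2:ℝ≥0∞) ≠ ∞) := ⟨by norm_num⟩
  have e : (fun p : Hs × Lp ℂ 2 ν => lam ν p.1 p.2) = fun p => DomMulAct.mk p.1⁻¹ • p.2 := by
    funext p
    apply Lp.ext
    filter_upwards [lam_ae ν p.1 p.2, DomMulAct.smul_Lp_ae_eq (DomMulAct.mk p.1⁻¹) p.2] with t h1 h2
    rw [h1, h2]
    simp
  rw [e]
  exact (DomMulAct.continuous_mk.comp continuous_fst.inv).smul continuous_snd

lemma nu_ac : ν ≪ wt ν := withDensity_absolutelyContinuous' wt_meas.aemeasurable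
  (Filter.Eventually.of_forall fun h => by
      have := hpos h 2
      simp only [ne_eq, ENNReal.ofReal_eq_zero, not_le]; positivity)

lemma ae_slice {P : PG → Prop} (h : ∀ᵐ t ∂(pm ν), P t) : ∀ᵐ v : E2, ∀ᵐ k : Hs ∂ν, P (bb v * (k : PG)) := by
  have h1 := ae_of_ae_map (mm.continuous.measurable.aemeasurable) h
  have h2 := Measure.ae_ae_of_ae_prod h1
  filter_upwards [h2] with v hv
  exact (nu_ac ν).ae_le hv

/-- the function to be sliced -/
noncomputable def jf (f : Lp ℂ 2 (pm ν)) : E2 × Hs → ℂ := fun p => (ww p.2 : ℂ) * f (bb p.1 * p.2)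

lemma jf_norm (f : Lp ℂ 2 (pm ν)) :
    ∫⁻ p, ‖jf ν f p‖ₑ ^ 2 ∂((volume : Measure E2).prod ν) = ∫⁻ t, ‖f t‖ₑ ^ 2 ∂(pm ν) := by
  have fm : Measurable f := (Lp.stronglyMeasurable f).measurable
  have fm2 : Measurable fun t => ‖f t‖ₑ ^ 2 := fm.enorm.pow_const 2
  have := lintegral_map (μ := (volume : Measure E2).prod (wt ν)) fm2 mm.continuous.measurable
  rw [← pm] at this
  have m1 : Measurable fun z : E2 × Hs => ENNReal.ofReal (mh z.2 2 2 ^ 3) := wt_meas.comp measurable_snd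
  have m2 : Measurable fun z : E2 × Hs => ‖f (mm z)‖ₑ ^ 2 := fm2.comp mm.continuous.measurable
  have e2 := lintegral_withDensity_eq_lintegral_mul ((volume : Measure E2).prod ν) m1 m2
  have e3 : (volume : Measure E2).prod (wt ν) =
      ((volume : Measure E2).prod ν).withDensity fun z : E2 × Hs => ENNReal.ofReal (mh z.2 2 2 ^ 3) := by
    rw [wt, prod_withDensity_right wt_meas]
  rw [this, e3, e2]
  refine lintegral_congr fun p => ?_
  simp only [jf, enorm_mul, mul_pow, ww_sq, Pi.mul_apply]
  rfl

lemma jf_mem (f : Lp ℂ 2 (pm ν)) : MemLp (jf ν f) 2 ((volume : Measure E2).prod ν) := by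
  have fm : Measurable f := (Lp.stronglyMeasurable f).measurable
  have m : Measurable (jf ν f) := by
    apply Measurable.mul
    · exact ((Complex.continuous_ofReal.comp ww_cont).comp continuous_snd).measurable
    · exact fm.comp mm.continuous.measurable
  refine ⟨m.aestronglyMeasurable, ?_⟩
  have h1 := jf_norm ν f
  rw [← eLpNorm_two_sq, ← eLpNorm_two_sq] at h1
  by_contra h
  rw [not_lt, top_le_iff] at h
  rw [h] at h1
  have := ENNReal.pow_lt_top (n := 2) (Lp.memLp f).2
  rw [← h1] at this
  simp at this

noncomputable def Jf (f : Lp ℂ 2 (pm ν)) : Lp (Lp ℂ 2 ν) 2 (volume : Measure E2) :=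
  (slice_exists volume ν (jf ν f) (jf_mem ν f)).choose
lemma Jf_ae (f : Lp ℂ 2 (pm ν)) : ∀ᵐ v : E2, ∀ᵐ h ∂ν, Jf ν f v h = (ww h : ℂ) * f (bb v * h) :=
  (slice_exists volume ν (jf ν f) (jf_mem ν f)).choose_spec.1
lemma Jf_enorm (f : Lp ℂ 2 (pm ν)) : ‖Jf ν f‖ₑ ^ 2 = ‖f‖ₑ ^ 2 :=
  ((slice_exists volume ν (jf ν f) (jf_mem ν f)).choose_spec.2.trans (jf_norm ν f)).trans
    (by rw [Lp.enorm_def, eLpNorm_two_sq])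
lemma norm_of_enorm {A B : Type*} [NormedAddCommGroup A] [NormedAddCommGroup B] (a : A) (b : B)
    (h : ‖a‖ₑ ^ 2 = ‖b‖ₑ ^ 2) : ‖a‖ = ‖b‖ := by
  have h1 := congrArg ENNReal.toReal h
  rw [ENNReal.toReal_pow, ENNReal.toReal_pow, toReal_enorm, toReal_enorm] at h1
  exact (pow_left_inj₀ (norm_nonneg _) (norm_nonneg _) two_ne_zero).1 h1
lemma Jf_norm (f : Lp ℂ 2 (pm ν)) : ‖Jf ν f‖ = ‖f‖ := norm_of_enorm _ _ (Jf_enorm ν f)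

attribute [irreducible] Jf

lemma Jf_add (f g : Lp ℂ 2 (pm ν)) : Jf ν (f + g) = Jf ν f + Jf ν g := by
  apply slice_uniq
  filter_upwards [Jf_ae ν f, Jf_ae ν g, Jf_ae ν (f + g), ae_slice ν (Lp.coeFn_add f g),
    Lp.coeFn_add (Jf ν f) (Jf ν g)] with v h1 h2 h3 h4 h5
  rw [h5]
  simp only [Pi.add_apply]
  filter_upwards [h1, h2, h3, h4, Lp.coeFn_add (Jf ν f v) (Jf ν g v)] with h h1 h2 h3 h4 h5
  rw [h3, h4, h5]
  simp only [Pi.add_apply, h1, h2]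
  ring
lemma Jf_smul (c : ℂ) (f : Lp ℂ 2 (pm ν)) : Jf ν (c • f) = c • Jf ν f := by
  apply slice_uniq
  filter_upwards [Jf_ae ν f, Jf_ae ν (c • f), ae_slice ν (Lp.coeFn_smul c f),
    Lp.coeFn_smul c (Jf ν f)] with v h1 h3 h4 h5
  rw [h5]
  simp only [Pi.smul_apply]
  filter_upwards [h1, h3, h4, Lp.coeFn_smul c (Jf ν f v)] with h h1 h3 h4 h5
  rw [h3, h4, h5]
  simp only [Pi.smul_apply, h1, smul_eq_mul]
  ring
noncomputable def Jl : Lp ℂ 2 (pm ν) →ₗᵢ[ℂ] Lp (Lp ℂ 2 ν) 2 (volume : Measure E2) where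
  toFun := Jf ν
  map_add' := Jf_add ν
  map_smul' := Jf_smul ν
  norm_map' := Jf_norm ν

variable [(pm ν).IsHaarMeasure]

lemma J_b (f : Lp ℂ 2 (pm ν)) (v0 : E2) : ∀ᵐ v, Jf ν (lam (pm ν) (bb v0) f) v = Jf ν f (v - v0) := by
  filter_upwards [Jf_ae ν (lam (pm ν) (bb v0) f), ae_slice ν (lam_ae (pm ν) (bb v0) f),
    (measurePreserving_sub_right volume v0).quasiMeasurePreserving.ae (Jf_ae ν f)] with v h1 h2 h3
  apply Lp.ext
  filter_upwards [h1, h2, h3] with h h1 h2 h3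
  rw [h1, h2, h3, ← bb_neg, ← mul_assoc, ← bb_add]
  congr 4
  abel

lemma J_h (f : Lp ℂ 2 (pm ν)) (h0 : Hs) : ∀ᵐ v, Jf ν (lam (pm ν) (h0 : PG) f) v =
    (ww h0 : ℂ) • lam ν h0 (Jf ν f ((sg h0).symm v)) := by
  have q : Measure.QuasiMeasurePreserving (sg h0).symm (volume : Measure E2) volume := by
    refine ⟨(sg h0).symm.continuous.measurable, ?_⟩
    rw [show ⇑(sg h0).symm = ⇑(sg h0⁻¹) from rfl, sg_map]
    exact Measure.smul_absolutelyContinuous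
  filter_upwards [Jf_ae ν (lam (pm ν) (h0 : PG) f), ae_slice ν (lam_ae (pm ν) (h0 : PG) f),
    q.ae (Jf_ae ν f)] with v h1 h2 h3
  apply Lp.ext
  have h3' := (measurePreserving_mul_left ν h0⁻¹).quasiMeasurePreserving.ae h3
  set x := Jf ν f ((sg h0).symm v) with hx
  have h5 := Lp.coeFn_smul (ww h0 : ℂ) (lam ν h0 x)
  filter_upwards [h1, h2, h3', lam_ae ν h0 x, h5] with h h1 h2 h3 h4 h5
  rw [h1, h2]
  change _ = ((ww h0 : ℂ) • (lam ν h0 x)) h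
  rw [h5, Pi.smul_apply, h4, h3, sg_symm', ← mul_assoc]
  rw [show ((h0 : PG)⁻¹ * bb v) = (h0⁻¹ : Hs) * bb v from rfl, conj_bb, smul_eq_mul, ← mul_assoc, mul_assoc (bb _)]
  congr 1
  rw [← Complex.ofReal_mul, ← ww_mul]
  simp

noncomputable def kap (h0 : Hs) : Lp ℂ 2 ν →L[ℂ] Lp ℂ 2 ν := (ww h0 : ℂ) • (lam ν h0).toContinuousLinearMap
lemma kap_apply (h0 : Hs) (x : Lp ℂ 2 ν) : kap ν h0 x = (ww h0 : ℂ) • lam ν h0 x := rfl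
attribute [irreducible] kap

/-- `L²` partial Fourier transform -/
noncomputable def Ph : Lp ℂ 2 (pm ν) →ₗᵢ[ℂ] Lp (Lp ℂ 2 ν) 2 (volume : Measure E2) :=
  (Lp.fourierTransformₗᵢ E2 (Lp ℂ 2 ν)).toLinearIsometry.comp (Jl ν)

lemma Ph_eq (f : Lp ℂ 2 (pm ν)) : Ph ν f = (𝓕 (Jf ν f) : Lp (Lp ℂ 2 ν) 2 (volume : Measure E2)) := rfl

lemma Ph_b (f : Lp ℂ 2 (pm ν)) (v0 : E2) : ∀ᵐ ξ, Ph ν (lam (pm ν) (bb v0) f) ξ =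
    Complex.exp (-2 * Real.pi * Complex.I * (inner ℝ v0 ξ : ℝ)) • Ph ν f ξ :=
  four_transl _ _ v0 (J_b ν f v0)

lemma kap_smul (h0 : Hs) (k : ℂ) (x : Lp ℂ 2 ν) : kap ν h0 (k • x) = ((ww h0 : ℂ) * k) • lam ν h0 x :=
  ((kap ν h0).map_smul k x).trans
    ((congrArg (k • ·) (kap_apply ν h0 x)).trans ((smul_smul k (ww h0 : ℂ) (lam ν h0 x)).trans (by rw [mul_comm])))
lemma Ph_h1 (f : Lp ℂ 2 (pm ν)) (h0 : Hs) :
    ∀ᵐ v, Jf ν (lam (pm ν) (h0 : PG) f) v = kap ν h0 (Jf ν f ((sg h0).symm v)) := by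
  filter_upwards [J_h ν f h0] with v hv
  rw [hv, kap_apply]
lemma Ph_h2 (f : Lp ℂ 2 (pm ν)) (h0 : Hs) : ∀ᵐ ξ, Ph ν (lam (pm ν) (h0 : PG) f) ξ =
    kap ν h0 ((((mh h0 2 2 ^ 3 : ℝ) : ℂ)⁻¹ : ℂ) • (Ph ν f (st h0 ξ))) :=
  four_lin (Jf ν f) (Jf ν (lam (pm ν) (h0 : PG) f)) (sg h0) (st h0) (st_adj h0) (mh h0 2 2 ^ 3)
    (pow_pos (hpos h0 2) 3) (sg_map h0) (st_map h0) (kap ν h0) (Ph_h1 ν f h0)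
lemma Ph_h (f : Lp ℂ 2 (pm ν)) (h0 : Hs) : ∀ᵐ ξ, Ph ν (lam (pm ν) (h0 : PG) f) ξ =
    rr h0 • lam ν h0 (Ph ν f (st h0 ξ)) := by
  filter_upwards [Ph_h2 ν f h0] with ξ hξ
  exact hξ.trans (kap_smul ν h0 _ _)
end phi
end PSL
end part6

section part7
open MeasureTheory Matrix Filter Topology
open scoped ENNReal FourierTransform
namespace PSL
section gen
variable {F : Type*} [NormedAddCommGroup F] [InnerProductSpace ℂ F] [CompleteSpace F]

lemma st_hh_cont : Continuous fun p : E2 × ℝ => st (hh p.2) p.1 := by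
  have h0 : Continuous fun p : E2 × ℝ => (st (hh p.2) p.1) 0 := by
    simp only [st0, hh00, hh22]; fun_prop
  have h1 : Continuous fun p : E2 × ℝ => (st (hh p.2) p.1) 1 := by
    simp only [st1, hh01, hh11, hh22]; fun_prop
  have : Continuous fun p : E2 × ℝ => WithLp.ofLp (st (hh p.2) p.1) := by
    refine continuous_pi fun i => ?_
    fin_cases i
    · exact h0
    · exact h1
  exact (PiLp.continuous_toLp 2 _).comp this

lemma test_exp (F1 G : Lp F 2 (volume : Measure E2))
    (h : ∀ v : E2, ∫ ξ, inner ℂ (G ξ) (Complex.exp (-2 * Real.pi * Complex.I * (inner ℝ v ξ : ℝ)) • F1 ξ) = 0) :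
    ∀ᵐ ξ, inner ℂ (G ξ) (F1 ξ) = 0 := by
  refine l1_uniq (fun ξ => inner ℂ (G ξ) (F1 ξ)) (L2.integrable_inner G F1) fun v => ?_
  rw [Real.fourier_eq', ← h v]
  refine integral_congr_ae (Eventually.of_forall fun ξ => ?_)
  simp only [inner_smul_right, smul_eq_mul]
  congr 2
  rw [real_inner_comm]
  push_cast
  ring

lemma dense_ae {p : ℝ → Prop} (h : ∀ᵐ d : ℝ, p d) : ∃ d : ℕ → ℝ, (∀ n, p (d n)) ∧ Tendsto d atTop (𝓝 0) := by
  have hd : Dense {d | p d} := Measure.dense_of_ae h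
  obtain ⟨d, h1, h2⟩ := mem_closure_iff_seq_limit.1 (hd 0)
  exact ⟨d, h1, h2⟩

/-- shear as a continuous map -/
noncomputable def shC (d : ℝ) : C(E2, E2) := ⟨fun v => lin (shM d) v, (lin (shM d)).continuous⟩
lemma shC_cont : Continuous shC := ContinuousMap.continuous_of_continuous_uncurry _ sh_cont

lemma sh_seq (F0 : Lp F 2 (volume : Measure E2)) (d : ℕ → ℝ) (hd : Tendsto d atTop (𝓝 0)) :
    ∃ ns : ℕ → ℕ, Tendsto ns atTop atTop ∧ ∀ᵐ ξ, Tendsto (fun n => F0 (lin (shM (d (ns n))) ξ)) atTop (𝓝 (F0 ξ)) := by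
  have t1 : Tendsto (fun n => shC (d n)) atTop (𝓝 (shC 0)) := (shC_cont.tendsto 0).comp hd
  have t2 := Tendsto.compMeasurePreservingLp (p := 2) (f := fun _ : ℕ => F0) (f₀ := F0) tendsto_const_nhds t1
    (μ := volume) (ν := volume) (fun n => sh_mp (d n)) (sh_mp 0) (by norm_num)
  obtain ⟨ns, hm, h⟩ := (tendstoInMeasure_of_tendsto_Lp t2).exists_seq_tendsto_ae
  refine ⟨ns, hm.tendsto_atTop, ?_⟩
  have e := fun n => Lp.coeFn_compMeasurePreserving F0 (sh_mp (d n))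
  have e0 := Lp.coeFn_compMeasurePreserving F0 (sh_mp 0)
  filter_upwards [h, ae_all_iff.2 e, e0] with ξ h1 h2 h3
  have : F0 ξ = Lp.compMeasurePreserving (lin (shM 0)) (sh_mp 0) F0 ξ := by
    rw [h3, Function.comp_apply, sh_zero]
  rw [this]
  refine h1.congr fun n => ?_
  exact h2 (ns n)

lemma key (K : ℝ → F →ₗᵢ[ℂ] F) (hK : Continuous fun p : ℝ × F => K p.1 p.2) (F0 G : Lp F 2 (volume : Measure E2))
    (h : ∀ w : ℝ, ∀ᵐ ξ, inner ℂ (G ξ) (K w (F0 (st (hh w) ξ))) = 0) :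
    ∀ᵐ ξ, inner ℂ (G ξ) (K (uu ξ) (F0 ξ)) = 0 := by
  have sG := Lp.stronglyMeasurable G
  have sF := Lp.stronglyMeasurable F0
  have sm : StronglyMeasurable fun p : E2 × ℝ => inner ℂ (G p.1) (K p.2 (F0 (st (hh p.2) p.1))) := by
    have a1 : StronglyMeasurable fun p : E2 × ℝ => F0 (st (hh p.2) p.1) :=
      sF.comp_measurable st_hh_cont.measurable
    have a2 : StronglyMeasurable fun p : E2 × ℝ => K p.2 (F0 (st (hh p.2) p.1)) :=
      hK.comp_stronglyMeasurable ((measurable_snd.stronglyMeasurable).prodMk a1)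
    exact (sG.comp_measurable measurable_fst).inner a2
  have ms : MeasurableSet {p : E2 × ℝ | inner ℂ (G p.1) (K p.2 (F0 (st (hh p.2) p.1))) = 0} :=
    sm.measurable (measurableSet_singleton 0)
  have h1 : ∀ᵐ ξ : E2, ∀ᵐ w : ℝ, inner ℂ (G ξ) (K w (F0 (st (hh w) ξ))) = 0 := by
    have ms' : MeasurableSet {p : ℝ × E2 | inner ℂ (G p.2) (K p.1 (F0 (st (hh p.1) p.2))) = 0} :=
      ms.preimage measurable_swap
    have := (Measure.ae_prod_iff_ae_ae (μ := (volume : Measure ℝ)) (ν := (volume : Measure E2)) ms').2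
      (Eventually.of_forall h)
    have h2 := (Measure.measurePreserving_swap (μ := (volume : Measure E2)) (ν := (volume : Measure ℝ))).quasiMeasurePreserving.ae this
    exact Measure.ae_ae_of_ae_prod h2
  have h2 : ∀ᵐ ξ : E2, ∀ᵐ d : ℝ, inner ℂ (G ξ) (K (uu ξ + d) (F0 (st (hh (uu ξ + d)) ξ))) = 0 := by
    filter_upwards [h1] with ξ hξ
    exact (measurePreserving_add_left volume (uu ξ)).quasiMeasurePreserving.ae hξ
  have h3 : ∀ᵐ d : ℝ, ∀ᵐ ξ : E2, inner ℂ (G ξ) (K (uu ξ + d) (F0 (st (hh (uu ξ + d)) ξ))) = 0 := by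
    have mm0 : Measurable fun p : E2 × ℝ => (p.1, uu p.1 + p.2) :=
      measurable_fst.prodMk ((uu_meas.comp measurable_fst).add measurable_snd)
    have := (Measure.ae_prod_iff_ae_ae (μ := (volume : Measure E2)) (ν := (volume : Measure ℝ))
      (ms.preimage mm0)).2 h2
    have h2 := (Measure.measurePreserving_swap (μ := (volume : Measure ℝ)) (ν := (volume : Measure E2))).quasiMeasurePreserving.ae this
    exact Measure.ae_ae_of_ae_prod h2
  obtain ⟨d, hd, hd0⟩ := dense_ae h3
  obtain ⟨ns, hns, hc⟩ := sh_seq F0 d hd0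
  filter_upwards [ae_all_iff.2 hd, hc, ae_ne] with ξ h4 h5 h6
  have t1 : Tendsto (fun n => uu ξ + d (ns n)) atTop (𝓝 (uu ξ)) := by
    simpa using (tendsto_const_nhds (x := uu ξ)).add (hd0.comp hns)
  have t2 := (hK.tendsto (uu ξ, F0 ξ)).comp (t1.prodMk_nhds h5)
  have t3 := Tendsto.inner (𝕜 := ℂ) (tendsto_const_nhds (x := G ξ)) t2
  refine tendsto_nhds_unique t3 ?_
  refine tendsto_const_nhds.congr fun n => ?_
  have := h4 (ns n)
  rw [sh_eq _ _ h6] at this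
  exact this.symm

section U
variable (K : ℝ → F →ₗᵢ[ℂ] F) (hK : Continuous fun p : ℝ × F => K p.1 p.2)
include hK
lemma U_mem (f : Lp F 2 (volume : Measure E2)) : MemLp (fun ξ => K (uu ξ) (f ξ)) 2 volume := by
  have a : StronglyMeasurable fun ξ => K (uu ξ) (f ξ) :=
    hK.comp_stronglyMeasurable (uu_meas.stronglyMeasurable.prodMk (Lp.stronglyMeasurable f))
  exact (Lp.memLp f).of_le a.aestronglyMeasurable (Eventually.of_forall fun ξ => by simp)
/-- fibrewise operator -/
noncomputable def U : Lp F 2 (volume : Measure E2) →ₗᵢ[ℂ] Lp F 2 (volume : Measure E2) where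
  toFun f := (U_mem K hK f).toLp
  map_add' f g := by
    apply Lp.ext
    filter_upwards [(U_mem K hK f).coeFn_toLp, (U_mem K hK g).coeFn_toLp, (U_mem K hK (f + g)).coeFn_toLp,
      Lp.coeFn_add f g, Lp.coeFn_add (U_mem K hK f).toLp (U_mem K hK g).toLp] with ξ h1 h2 h3 h4 h5
    rw [h5, h3, h4, Pi.add_apply, Pi.add_apply, h1, h2, map_add]
  map_smul' c f := by
    apply Lp.ext
    filter_upwards [(U_mem K hK f).coeFn_toLp, (U_mem K hK (c • f)).coeFn_toLp,
      Lp.coeFn_smul c f, Lp.coeFn_smul c (U_mem K hK f).toLp] with ξ h1 h3 h4 h5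
    rw [RingHom.id_apply, h5, h3, h4, Pi.smul_apply, Pi.smul_apply, h1, map_smul]
  norm_map' f := by
    change ‖(U_mem K hK f).toLp‖ = ‖f‖
    rw [Lp.norm_toLp, Lp.norm_def]
    congr 1
    apply eLpNorm_congr_norm_ae
    exact Eventually.of_forall fun ξ => by simp
lemma U_ae (f : Lp F 2 (volume : Measure E2)) : ∀ᵐ ξ, U K hK f ξ = K (uu ξ) (f ξ) := (U_mem K hK f).coeFn_toLp
end U
end gen
end PSL
end part7

section part8
open MeasureTheory Matrix Filter Topology
open scoped ENNReal FourierTransform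
namespace PSL
section abs
variable {F H : Type*} [NormedAddCommGroup F] [InnerProductSpace ℂ F] [CompleteSpace F]
  [NormedAddCommGroup H] [InnerProductSpace ℂ H] [CompleteSpace H]
  (L : Hs → F →ₗᵢ[ℂ] F) (hLc : Continuous fun p : Hs × F => L p.1 p.2)
  (hLm : ∀ g h x, L (g * h) x = L g (L h x))
  (R : PG → H →ₗᵢ[ℂ] H) (hRm : ∀ g h x, R (g * h) x = R g (R h x)) (hR1 : ∀ x, R 1 x = x)
  (Φ : H →ₗᵢ[ℂ] Lp F 2 (volume : Measure E2))
  (hb : ∀ f v, ∀ᵐ ξ, Φ (R (bb v) f) ξ = Complex.exp (-2 * Real.pi * Complex.I * (inner ℝ v ξ : ℝ)) • Φ f ξ)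
  (hs : ∀ f (h : Hs), ∀ᵐ ξ, Φ (R (h : PG) f) ξ = rr h • L h (Φ f (st h ξ)))

/-- operators along the line -/
noncomputable def KK (w : ℝ) : F →ₗᵢ[ℂ] F := L (hh w)

include hLc in
lemma KK_cont : Continuous fun p : ℝ × F => KK L p.1 p.2 :=
  hLc.comp ((hh_cont.comp continuous_fst).prodMk continuous_snd)

include hRm hb hs in
lemma U_pres (V : Submodule ℂ H) (hV : IsClosed (V : Set H)) (hinv : ∀ g, ∀ f ∈ V, R g f ∈ V) (f : H) (hf : f ∈ V) :
    ∃ f' ∈ V, Φ f' = U (KK L) (KK_cont L hLc) (Φ f) := by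
  set V' := V.map Φ.toLinearMap with hV'
  have cV : CompleteSpace V := hV.completeSpace_coe
  have hc : IsComplete (V' : Set (Lp F 2 (volume : Measure E2))) := by
    have : (V' : Set (Lp F 2 (volume : Measure E2))) = Φ '' V := rfl
    rw [this]
    exact (Φ.isometry.isUniformInducing.isComplete_iff).2 hV.isComplete
  haveI : CompleteSpace V' := hc.completeSpace_coe
  have goal : U (KK L) (KK_cont L hLc) (Φ f) ∈ V' := by
    rw [← Submodule.orthogonal_orthogonal V', Submodule.mem_orthogonal]
    intro G hG
    have hG' : ∀ g ∈ V, inner ℂ G (Φ g) = 0 := fun g hg =>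
      (Submodule.mem_orthogonal' _ _).1 hG _ (Submodule.mem_map_of_mem (f := Φ.toLinearMap) hg)
    have k := key (KK L) (KK_cont L hLc) (Φ f) G (fun w => by
      have := test_exp (Φ (R (hh w : PG) f)) G (fun v => by
        rw [← hG' _ (hinv (bb v) _ (hinv (hh w : PG) f hf)), L2.inner_def]
        refine integral_congr_ae ?_
        filter_upwards [hb (R (hh w : PG) f) v] with ξ h1
        rw [h1])
      filter_upwards [this, hs f (hh w)] with ξ h1 h2
      rw [h2, inner_smul_right] at h1
      exact (mul_eq_zero.1 h1).resolve_left (rr_ne _))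
    rw [L2.inner_def]
    refine integral_eq_zero_of_ae ?_
    filter_upwards [k, U_ae (KK L) (KK_cont L hLc) (Φ f)] with ξ h1 h2
    rw [h2, h1]; rfl
  obtain ⟨f', h1, h2⟩ := goal
  exact ⟨f', h1, h2⟩

include hb in
lemma R_b (f f' : H) (h : Φ f' = U (KK L) (KK_cont L hLc) (Φ f)) (v : E2) :
    Φ (R (bb v) f') = U (KK L) (KK_cont L hLc) (Φ (R (bb v) f)) := by
  apply Lp.ext
  filter_upwards [hb f v, hb f' v, U_ae (KK L) (KK_cont L hLc) (Φ f), U_ae (KK L) (KK_cont L hLc) (Φ (R (bb v) f))]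
    with ξ h1 h2 h3 h4
  rw [h2, h4, h1, h, h3, map_smul]

include hLm hs in
lemma R_h (f f' : H) (h : Φ f' = U (KK L) (KK_cont L hLc) (Φ f)) (g : Hs) :
    Φ (R (g : PG) f') = U (KK L) (KK_cont L hLc) (Φ (R (g : PG) f)) := by
  have q : Measure.QuasiMeasurePreserving (st g) (volume : Measure E2) volume := by
    refine ⟨(st g).continuous.measurable, ?_⟩
    rw [st_map]
    exact Measure.smul_absolutelyContinuous
  apply Lp.ext
  filter_upwards [hs f g, hs f' g, q.ae (U_ae (KK L) (KK_cont L hLc) (Φ f)),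
    U_ae (KK L) (KK_cont L hLc) (Φ (R (g : PG) f)), ae_ne] with ξ h1 h2 h3 h4 h5
  rw [h2, h4, h1, h, h3, map_smul]
  congr 1
  rw [KK, KK, ← hLm, ← hLm, hh_comm g ξ h5]

include hLm hRm hb hs in
lemma R_g (f f' : H) (h : Φ f' = U (KK L) (KK_cont L hLc) (Φ f)) (g : PG) :
    Φ (R g f') = U (KK L) (KK_cont L hLc) (Φ (R g f)) := by
  obtain ⟨⟨v, k⟩, rfl⟩ := mm.surjective g
  rw [mm_apply, hRm, hRm]
  exact R_b L hLc R Φ hb _ _ (R_h L hLc hLm R Φ hs _ _ h k) v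

set_option maxHeartbeats 2000000 in
include hLc hLm hRm hR1 hb hs in
lemma concl (V : Submodule ℂ H) (hV : IsClosed (V : Set H)) (hinv : ∀ g, ∀ f ∈ V, R g f ∈ V)
    (hirr : ∀ W : Submodule ℂ H, IsClosed (W : Set H) → (∀ g, ∀ f ∈ W, R g f ∈ W) → W ≤ V → W = ⊥ ∨ W = V)
    (hE : ∀ (w : ℝ) (x : F) (c : ℂ), L (hh w) x = c • x → x = 0) : V = ⊥ := by
  by_contra hne
  have cV : CompleteSpace V := hV.completeSpace_coe
  haveI : Nontrivial V := Submodule.nontrivial_iff_ne_bot.2 hne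
  set UU := U (KK L) (KK_cont L hLc) with hUU
  set T0 : H →L[ℂ] H := (ContinuousLinearMap.adjoint Φ.toContinuousLinearMap) ∘L
    (UU.toContinuousLinearMap ∘L Φ.toContinuousLinearMap) with hT0
  have adj : ∀ f, ContinuousLinearMap.adjoint Φ.toContinuousLinearMap (Φ f) = f := by
    intro f
    refine ext_inner_right ℂ fun g => ?_
    rw [ContinuousLinearMap.adjoint_inner_left]
    exact Φ.inner_map_map f g
  have T0V : ∀ f ∈ V, T0 f ∈ V ∧ Φ (T0 f) = UU (Φ f) := by
    intro f hf
    obtain ⟨f', h1, h2⟩ := U_pres L hLc R hRm Φ hb hs V hV hinv f hf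
    have : T0 f = f' := by
      change ContinuousLinearMap.adjoint Φ.toContinuousLinearMap (UU (Φ f)) = f'
      rw [← h2, adj]
    rw [this]
    exact ⟨h1, h2⟩
  set T : V →L[ℂ] V := T0.restrict (fun x hx => (T0V x hx).1) with hT
  set S : PG → V →L[ℂ] V := fun g => (R g).toContinuousLinearMap.restrict (hinv g) with hS
  have Sa : ∀ g (x : V), ((S g x : V) : H) = R g x := fun g x => rfl
  have Ta : ∀ (x : V), ((T x : V) : H) = T0 x := fun x => rfl
  obtain ⟨c, hc⟩ := schur S (fun g => ⟨g⁻¹, by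
      rw [ContinuousLinearMap.star_eq_adjoint]
      symm
      rw [ContinuousLinearMap.eq_adjoint_iff]
      intro x y
      rw [Submodule.coe_inner, Submodule.coe_inner, Sa, Sa, ← (R g).inner_map_map, ← hRm, mul_inv_cancel, hR1]⟩)
    (fun W hW hi => by
      have hle : W.map V.subtype ≤ V := by
        rintro _ ⟨x, _, rfl⟩; exact x.2
      rcases hirr (W.map V.subtype) (by
        have : ((W.map V.subtype : Submodule ℂ H) : Set H) = Subtype.val '' (W : Set V) := rfl
        rw [this]
        exact hV.isClosedEmbedding_subtypeVal.isClosedMap _ hW)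
        (by
          rintro g _ ⟨x, hx, rfl⟩
          exact ⟨S g x, hi g x hx, rfl⟩) hle with h | h
      · left
        rw [eq_bot_iff]
        intro x hx
        have hm : (x : H) ∈ W.map V.subtype := ⟨x, hx, rfl⟩
        rw [h, Submodule.mem_bot] at hm
        exact (Submodule.mem_bot ℂ).2 (Subtype.ext hm)
      · right
        rw [eq_top_iff]
        intro x _
        have : (x : H) ∈ W.map V.subtype := by rw [h]; exact x.2
        obtain ⟨y, hy, hyx⟩ := this
        have : y = x := Subtype.ext hyx
        exact this ▸ hy) T (fun g => by
      ext x
      change ((T (S g x) : V) : H) = ((S g (T x) : V) : H)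
      rw [Ta, Sa, Sa, Ta]
      apply Φ.injective
      rw [(T0V _ (hinv g x x.2)).2]
      exact (R_g L hLc hLm R hRm Φ hb hs x (T0 x) (T0V x x.2).2 g).symm)
  apply hne
  rw [eq_bot_iff]
  intro f hf
  have e1 : T0 f = c • f := by
    have := congrArg (fun A : V →L[ℂ] V => ((A ⟨f, hf⟩ : V) : H)) hc
    exact this
  have e2 : UU (Φ f) = c • Φ f := by rw [← (T0V f hf).2, e1, map_smul]
  have e3 : Φ f = 0 := by
    apply Lp.ext
    filter_upwards [U_ae (KK L) (KK_cont L hLc) (Φ f), Lp.coeFn_smul c (Φ f), Lp.coeFn_zero F 2 (volume : Measure E2)]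
      with ξ h1 h2 h3
    rw [← hUU, e2, h2] at h1
    rw [h3]
    exact hE (uu ξ) _ c h1.symm
  rw [Submodule.mem_bot]
  exact Φ.injective (e3.trans (map_zero Φ).symm)
end abs

section eig
variable [MeasurableSpace PG] [BorelSpace PG] (ν : Measure Hs) [ν.IsHaarMeasure]

lemma eig (h0 : Hs) (h2 : mh h0 0 0 = 2) (f : Lp ℂ 2 ν) (c : ℂ) (hf : lam ν h0 f = c • f) : f = 0 := by
  by_contra hne
  have hc : ‖c‖ = 1 := by
    have := congrArg norm hf
    rw [(lam ν h0).norm_map, norm_smul] at this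
    have hp : ‖f‖ ≠ 0 := norm_ne_zero_iff.2 hne
    field_simp at this
    exact this.symm
  have fm : Measurable fun t => ‖f t‖ₑ ^ 2 := (Lp.stronglyMeasurable f).measurable.enorm.pow_const 2
  have hin : ∀ᵐ t ∂ν, ‖f (h0⁻¹ * t)‖ₑ ^ 2 = ‖f t‖ₑ ^ 2 := by
    filter_upwards [lam_ae ν h0 f, Lp.coeFn_smul c f] with t h1 h3
    rw [← h1, hf, h3, Pi.smul_apply, enorm_smul, ← ofReal_norm c, hc]
    simp
  set m := ν.withDensity fun t => ‖f t‖ₑ ^ 2 with hm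
  have mu : m Set.univ = ‖f‖ₑ ^ 2 := by
    rw [hm, withDensity_apply _ MeasurableSet.univ, setLIntegral_univ, ← eLpNorm_two_sq, Lp.enorm_def]
  haveI : IsFiniteMeasure m := ⟨by rw [mu]; exact ENNReal.pow_lt_top enorm_lt_top⟩
  have mp : MeasurePreserving (fun t => h0⁻¹ * t) m m := by
    refine ⟨measurable_const_mul _, ?_⟩
    ext s hs
    rw [Measure.map_apply (measurable_const_mul _) hs, hm, withDensity_apply _ hs,
      withDensity_apply _ (measurable_const_mul _ hs),
      ← (measurePreserving_mul_left ν h0⁻¹).setLIntegral_comp_preimage hs fm]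
    exact lintegral_congr_ae (ae_restrict_of_ae (hin.mono fun t ht => ht.symm))
  have it : ∀ (n : ℕ) (x : Hs), mh ((fun t => h0⁻¹ * t)^[n] x) 0 0 * 2 ^ n = mh x 0 0 := by
    intro n
    induction n with
    | zero => intro x; simp
    | succ n ih =>
      intro x
      rw [Function.iterate_succ_apply, pow_succ, ← mul_assoc, ih, mul_comm, ← h2, ← mh_mul00]
      simp
  set E : ℤ → Set Hs := fun k => {x | mh x 0 0 ∈ Set.Ico ((2:ℝ) ^ k) (2 ^ (k + 1))} with hE
  have Em : ∀ k, MeasurableSet (E k) := fun k => measurableSet_Ico.preimage (enth_cont 0 0).measurable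
  have E0 : ∀ k, m (E k) = 0 := by
    intro k
    by_contra h
    obtain ⟨x, hx, n, hn, hxn⟩ := mp.conservative.exists_mem_iterate_mem (Em k).nullMeasurableSet h
    have h3 := it n x
    have h4 : (2:ℝ) ≤ 2 ^ n := by
      calc (2:ℝ) = 2 ^ 1 := by norm_num
        _ ≤ 2 ^ n := pow_le_pow_right₀ (by norm_num) (Nat.one_le_iff_ne_zero.2 hn)
    have h5 := hxn.1
    have h6 := hx.2
    rw [zpow_add₀ (by norm_num), zpow_one] at h6
    have h7 : (0:ℝ) < 2 ^ k := by positivity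
    nlinarith
  have : m Set.univ = 0 := by
    have : (Set.univ : Set Hs) = ⋃ k, E k := by
      symm
      rw [Set.eq_univ_iff_forall]
      intro x
      obtain ⟨k, hk⟩ := exists_mem_Ico_zpow (hpos x 0) (one_lt_two)
      exact Set.mem_iUnion.2 ⟨k, hk⟩
    rw [this]
    exact measure_iUnion_null E0
  rw [mu] at this
  simp at this
  exact hne this
end eig
end PSL
end part8

open PSL

/-- The regular representation of the minimal parabolic subgroup of `SL(3, ℝ)` has no
irreducible subrepresentation. -/
theorem parabolicSL3_no_irreducible_subrepresentation
    [MeasurableSpace ParabolicSL3] [BorelSpace ParabolicSL3]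
    (μ : Measure ParabolicSL3) [μ.IsHaarMeasure] :
    ¬ ∃ V : Submodule ℂ (Lp ℂ 2 μ), IsIrreducibleSubspace μ V := by
  rintro ⟨V, hV, hinv, hne, hirr⟩
  obtain ⟨ν, hν, rfl⟩ := exists_nu μ
  refine hne (concl (lam ν) (lam_cont ν) (lam_mul ν) (lam (pm ν)) (lam_mul _) (lam_one _) (Ph ν)
    (Ph_b ν) (Ph_h ν) V hV (fun g f hf => hinv g f hf _ (lam_ae (pm ν) g f)) ?_ ?_)
  · intro W hW hi hle
    refine hirr W hW (fun g ξ hξ η hη => ?_) hle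
    have : η = lam (pm ν) g ξ := by
      apply Lp.ext
      filter_upwards [hη, lam_ae (pm ν) g ξ] with t h1 h2
      rw [h1, h2]
    rw [this]
    exact hi g ξ hξ
  · intro w x c h
    exact eig ν (hh w) (hh00 w) x c h
end

section
/- Let μ be the additive Haar measure on ℚ_p² normalized so that μ(ℤ_p × ℤ_p) = 1, and let C = ℤ_p × ℤ_p. The function φ on UL(2, ℚ_p) defined by φ(m) = μ(m·C ∩ C) (where m·C is the image of C under matrix multiplication by m) takes values in [0, 1] and vanishes at infinity: for every ε > 0 there is a compact subset S of UL(2, ℚ_p) such that φ(m) < ε for all m ∈ UL(2, ℚ_p) \ S. -/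
open MeasureTheory Matrix
open scoped ENNReal

variable (p : ℕ) [Fact p.Prime]

/-- `UL(2, ℚ_p)`: the subgroup of `GL(2, ℚ_p)` of matrices whose determinant has p-adic
norm `1`. -/
noncomputable def UL2 : Subgroup (GL (Fin 2) ℚ_[p]) where
  carrier := {g | ‖(g : Matrix (Fin 2) (Fin 2) ℚ_[p]).det‖ = 1}
  one_mem' := by simp [Units.val_one]
  mul_mem' := by
    intro g g' hg hg'
    simp only [Set.mem_setOf_eq] at *
    rw [Units.val_mul, Matrix.det_mul, norm_mul, hg, hg', mul_one]
  inv_mem' := by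
    intro g hg
    simp only [Set.mem_setOf_eq] at *
    have h : ((g⁻¹ : GL (Fin 2) ℚ_[p]) : Matrix (Fin 2) (Fin 2) ℚ_[p]).det *
        (g : Matrix (Fin 2) (Fin 2) ℚ_[p]).det = 1 := by
      rw [← Matrix.det_mul, ← Units.val_mul, inv_mul_cancel, Units.val_one, Matrix.det_one]
    have h' := congrArg norm h
    rw [norm_mul, hg, mul_one, norm_one] at h'
    exact h'

/-- The compact sets of `UL2` used for exhaustion. -/
theorem isCompact_UL2_aux (R : ℝ) :
    IsCompact {m : UL2 p | ∀ i j, ‖((m⁻¹ : UL2 p) : GL (Fin 2) ℚ_[p]).1 i j‖ ≤ R} := by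
  let K : Set (Matrix (Fin 2) (Fin 2) ℚ_[p]) := {A | (∀ i j, ‖A i j‖ ≤ R) ∧ ‖A.det‖ = 1}
  have hK : IsCompact K := by
    have h1 : IsCompact (Set.univ.pi fun _ : Fin 2 => Set.univ.pi fun _ : Fin 2 =>
        Metric.closedBall (0 : ℚ_[p]) R) :=
      isCompact_univ_pi fun _ => isCompact_univ_pi fun _ => isCompact_closedBall _ _
    have h2 : IsClosed {A : Matrix (Fin 2) (Fin 2) ℚ_[p] | ‖A.det‖ = 1} :=
      isClosed_eq (by fun_prop) continuous_const
    have h3 : K = (Set.univ.pi fun _ : Fin 2 => Set.univ.pi fun _ : Fin 2 =>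
        Metric.closedBall (0 : ℚ_[p]) R) ∩ {A : Matrix (Fin 2) (Fin 2) ℚ_[p] | ‖A.det‖ = 1} := by
      ext A
      constructor
      · rintro ⟨h, h'⟩
        exact ⟨fun i _ j _ => by simpa using h i j, h'⟩
      · rintro ⟨h, h'⟩
        exact ⟨fun i j => by simpa using h i trivial j trivial, h'⟩
    rw [h3]
    exact h1.inter_right h2
  have hdet : ∀ A : K, (A : Matrix (Fin 2) (Fin 2) ℚ_[p]).det ≠ 0 := by
    intro A h
    have := A.2.2
    rw [h] at this
    simp at this
  let g : K → GL (Fin 2) ℚ_[p] := fun A =>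
    ⟨A.1, (A.1.det)⁻¹ • A.1.adjugate,
      by rw [Matrix.mul_smul, Matrix.mul_adjugate, smul_smul, inv_mul_cancel₀ (hdet A), one_smul],
      by rw [Matrix.smul_mul, Matrix.adjugate_mul, smul_smul, inv_mul_cancel₀ (hdet A), one_smul]⟩
  have hg : Continuous g := by
    rw [Units.continuous_iff]
    constructor
    · exact continuous_subtype_val
    · have hc : Continuous fun A : K => (A.1.det)⁻¹ • A.1.adjugate := by
        exact Continuous.smul (Continuous.inv₀ (continuous_subtype_val.matrix_det) hdet)
          continuous_subtype_val.matrix_adjugate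
      exact hc
  let f : K → UL2 p := fun A => ⟨g A, A.2.2⟩
  have hf : Continuous f := hg.subtype_mk _
  haveI : CompactSpace K := isCompact_iff_compactSpace.mp hK
  have hr := isCompact_range hf.inv
  convert hr using 1
  ext m
  constructor
  · intro hm
    refine ⟨⟨((m⁻¹ : UL2 p) : GL (Fin 2) ℚ_[p]).1, hm, (m⁻¹).2⟩, ?_⟩
    have : f ⟨((m⁻¹ : UL2 p) : GL (Fin 2) ℚ_[p]).1, hm, (m⁻¹).2⟩ = m⁻¹ := by
      apply Subtype.ext
      apply Units.ext
      rfl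
    exact (congrArg (fun x => x⁻¹) this).trans (inv_inv m)
  · rintro ⟨A, rfl⟩
    intro i j
    have h : ((f⁻¹ A)⁻¹ : UL2 p) = f A := inv_inv (f A)
    rw [h]
    exact A.2.1 i j

theorem padic_norm_sub_le (a b : ℚ_[p]) : ‖a - b‖ ≤ max ‖a‖ ‖b‖ := by
  rw [sub_eq_add_neg, ← norm_neg b]
  exact Padic.nonarchimedean a (-b)

theorem measure_slab_aux
    [MeasurableSpace (Fin 2 → ℚ_[p])] [BorelSpace (Fin 2 → ℚ_[p])]
    (μ : Measure (Fin 2 → ℚ_[p])) [μ.IsAddHaarMeasure]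
    (hμ : μ {v : Fin 2 → ℚ_[p] | ∀ i, ‖v i‖ ≤ 1} = 1)
    (w : Fin 2 → ℚ_[p]) (s : Fin 2) (k : ℕ) (hw : (p : ℝ) ^ k < ‖w s‖) :
    ((p ^ k : ℕ) : ℝ≥0∞) * μ {v : Fin 2 → ℚ_[p] | (∀ i, ‖v i‖ ≤ 1) ∧ ‖w ⬝ᵥ v‖ ≤ 1} ≤ 1 := by
  have hp : (0 : ℝ) < p := by exact_mod_cast (Fact.out : p.Prime).pos
  set E := {v : Fin 2 → ℚ_[p] | (∀ i, ‖v i‖ ≤ 1) ∧ ‖w ⬝ᵥ v‖ ≤ 1} with hE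
  have hEc : IsClosed E := by
    have h1 : IsClosed {v : Fin 2 → ℚ_[p] | ∀ i, ‖v i‖ ≤ 1} := by
      simp only [Set.setOf_forall]
      exact isClosed_iInter fun i => isClosed_le (by fun_prop) continuous_const
    have h2 : IsClosed {v : Fin 2 → ℚ_[p] | ‖w ⬝ᵥ v‖ ≤ 1} :=
      isClosed_le (Continuous.norm (continuous_const.dotProduct continuous_id)) continuous_const
    exact h1.inter h2
  let e : ℕ → (Fin 2 → ℚ_[p]) := fun t => Pi.single s (t : ℚ_[p])
  let F : ℕ → Set (Fin 2 → ℚ_[p]) := fun t => (fun v => e t + v) ⁻¹' E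
  have hFμ : ∀ t, μ (F t) = μ E := fun t => measure_preimage_add μ (e t) E
  have hFm : ∀ t, MeasurableSet (F t) := fun t =>
    (hEc.preimage (by fun_prop)).measurableSet
  have hsub : (⋃ t ∈ Finset.range (p ^ k), F t) ⊆ {v : Fin 2 → ℚ_[p] | ∀ i, ‖v i‖ ≤ 1} := by
    intro v hv
    simp only [Set.mem_iUnion] at hv
    obtain ⟨t, -, hv⟩ := hv
    intro i
    have h1 : ‖e t i + v i‖ ≤ 1 := hv.1 i
    have h2 : ‖e t i‖ ≤ 1 := by
      by_cases h : i = s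
      · subst h
        simpa [e] using Padic.norm_int_le_one (p := p) (t : ℤ)
      · simp [e, h]
    have h3 : v i = (e t i + v i) - e t i := by ring
    rw [h3]
    exact (padic_norm_sub_le p _ _).trans (max_le h1 h2)
  have hdisj : Set.PairwiseDisjoint (↑(Finset.range (p ^ k))) F := by
    intro t ht t' ht' hne
    rw [Function.onFun, Set.disjoint_left]
    intro v hv hv'
    simp only [Finset.coe_range, Set.mem_Iio] at ht ht'
    have h1 : ‖w ⬝ᵥ (e t + v)‖ ≤ 1 := hv.2
    have h2 : ‖w ⬝ᵥ (e t' + v)‖ ≤ 1 := hv'.2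
    have h3 : w ⬝ᵥ (e t + v) - w ⬝ᵥ (e t' + v) = w s * (((t : ℤ) - (t' : ℤ) : ℤ) : ℚ_[p]) := by
      simp only [dotProduct_add, e, dotProduct_single]
      push_cast
      ring
    have h4 : ‖w s * (((t : ℤ) - (t' : ℤ) : ℤ) : ℚ_[p])‖ ≤ 1 := by
      rw [← h3]
      exact (padic_norm_sub_le p _ _).trans (max_le h1 h2)
    rw [norm_mul] at h4
    have h5 : ‖(((t : ℤ) - (t' : ℤ) : ℤ) : ℚ_[p])‖ ≤ (p : ℝ) ^ (-(k : ℤ)) := by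
      rw [_root_.zpow_neg, zpow_natCast]
      rw [le_inv_comm₀ (norm_pos_iff.mpr ?_) (by positivity)]
      · refine hw.le.trans ?_
        rw [← one_div, le_div_iff₀ (norm_pos_iff.mpr ?_)]
        · exact h4
        · exact Int.cast_ne_zero.mpr (by omega)
      · exact Int.cast_ne_zero.mpr (by omega)
    rw [Padic.norm_int_le_pow_iff_dvd] at h5
    have h6 := Int.eq_zero_of_abs_lt_dvd h5 (by
      push_cast
      have a : (t : ℤ) < (p : ℤ) ^ k := by exact_mod_cast ht
      have b : (t' : ℤ) < (p : ℤ) ^ k := by exact_mod_cast ht'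
      rw [abs_lt]
      constructor <;> omega)
    omega
  have hsum := measure_biUnion_finset (μ := μ) hdisj (fun t _ => hFm t)
  simp only [hFμ, Finset.sum_const, Finset.card_range, nsmul_eq_mul] at hsum
  rw [← hsum, ← hμ]
  exact measure_mono hsub

/-- The function `φ(m) = μ(m·C ∩ C)` on `UL(2, ℚ_p)`, where `C = ℤ_p × ℤ_p`, takes values in
`[0, 1]` and vanishes at infinity. -/
theorem measure_inter_closedBall_vanishes_at_infinity
    [MeasurableSpace (Fin 2 → ℚ_[p])] [BorelSpace (Fin 2 → ℚ_[p])]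
    (μ : Measure (Fin 2 → ℚ_[p])) [μ.IsAddHaarMeasure]
    (hμ : μ {v : Fin 2 → ℚ_[p] | ∀ i, ‖v i‖ ≤ 1} = 1) :
    (∀ m : UL2 p,
      μ (((m : GL (Fin 2) ℚ_[p]) : Matrix (Fin 2) (Fin 2) ℚ_[p]).mulVec ''
            {v : Fin 2 → ℚ_[p] | ∀ i, ‖v i‖ ≤ 1} ∩ {v : Fin 2 → ℚ_[p] | ∀ i, ‖v i‖ ≤ 1}) ≤ 1) ∧
    (∀ ε : ℝ≥0∞, 0 < ε → ∃ S : Set (UL2 p), IsCompact S ∧ ∀ m : UL2 p, m ∉ S →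
      μ (((m : GL (Fin 2) ℚ_[p]) : Matrix (Fin 2) (Fin 2) ℚ_[p]).mulVec ''
            {v : Fin 2 → ℚ_[p] | ∀ i, ‖v i‖ ≤ 1} ∩ {v : Fin 2 → ℚ_[p] | ∀ i, ‖v i‖ ≤ 1}) < ε) := by
  constructor
  · intro m
    exact (measure_mono Set.inter_subset_right).trans hμ.le
  · intro ε hε
    obtain ⟨n, hn⟩ := ENNReal.exists_inv_nat_lt hε.ne'
    have hnk : n ≤ p ^ n := (Nat.lt_pow_self (Fact.out : p.Prime).one_lt).le
    refine ⟨_, isCompact_UL2_aux p ((p : ℝ) ^ n), ?_⟩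
    intro m hm
    simp only [Set.mem_setOf_eq, not_forall, not_le] at hm
    obtain ⟨r, s, hrs⟩ := hm
    have hb := measure_slab_aux p μ hμ (((m⁻¹ : UL2 p) : GL (Fin 2) ℚ_[p]).1 r) s n hrs
    refine lt_of_le_of_lt ?_ hn
    refine (measure_mono ?_).trans (b := μ {v : Fin 2 → ℚ_[p] | (∀ i, ‖v i‖ ≤ 1) ∧
      ‖(((m⁻¹ : UL2 p) : GL (Fin 2) ℚ_[p]).1 r) ⬝ᵥ v‖ ≤ 1}) ?_
    · rintro x ⟨⟨v, hv, rfl⟩, hx⟩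
      refine ⟨hx, ?_⟩
      have h1 : ((m⁻¹ : UL2 p) : GL (Fin 2) ℚ_[p]).1 *ᵥ ((m : GL (Fin 2) ℚ_[p]).1 *ᵥ v) = v := by
        rw [Matrix.mulVec_mulVec, ← Units.val_mul, ← Subgroup.coe_mul, inv_mul_cancel]
        simp
      have h2 := congrFun h1 r
      have h3 := hv r
      rw [← h2] at h3
      exact h3
    · rw [ENNReal.le_inv_iff_mul_le, mul_comm]
      refine le_trans ?_ hb
      gcongr
end

section
/- Let μ be the additive Haar measure on ℚ_p² normalized so that μ(ℤ_p × ℤ_p) = 1, let C = ℤ_p × ℤ_p, and let m = [[a, b], [0, d]] be an upper triangular matrix in GL(2, ℚ_p) with |a|_p · |d|_p = 1. Then μ(m·C ∩ C) ≤ min(|a|_p⁻¹, |d|_p⁻¹); and if moreover b ≠ 0, then μ(m·C ∩ C) ≤ 2 · min(|a|_p⁻¹, |b|_p⁻¹, |d|_p⁻¹). -/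
open MeasureTheory Matrix
open scoped ENNReal

theorem padic_sub_le (p : ℕ) [Fact p.Prime] (x y : ℚ_[p]) : ‖x - y‖ ≤ max ‖x‖ ‖y‖ := by
  have := Padic.nonarchimedean x (-y)
  rwa [← sub_eq_add_neg, norm_neg] at this

theorem exists_pow_norm (p : ℕ) [Fact p.Prime] (u : ℚ_[p]) (hu : u ≠ 0) (h : ‖u‖ ≤ 1) :
    ∃ n : ℕ, ‖u‖ = (p : ℝ) ^ (-(n : ℤ)) := by
  have h0 : 0 ≤ u.valuation := (Padic.norm_le_one_iff_val_nonneg u).1 h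
  refine ⟨u.valuation.toNat, ?_⟩
  rw [Padic.norm_eq_zpow_neg_valuation hu, Int.toNat_of_nonneg h0]

theorem fin_eq_of_norm (p : ℕ) [Fact p.Prime] (n : ℕ) (i j : Fin (p ^ n))
    (h : ‖((i : ℕ) : ℚ_[p]) - ((j : ℕ) : ℚ_[p])‖ ≤ (p : ℝ) ^ (-(n : ℤ))) : i = j := by
  have h2 : ‖((((i : ℕ) : ℤ) - ((j : ℕ) : ℤ) : ℤ) : ℚ_[p])‖ ≤ (p : ℝ) ^ (-(n : ℤ)) := by
    push_cast
    exact h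
  rw [Padic.norm_int_le_pow_iff_dvd] at h2
  have hi := i.2
  have hj := j.2
  have h3 : ((i : ℕ) : ℤ) - ((j : ℕ) : ℤ) = 0 := by
    apply Int.eq_zero_of_abs_lt_dvd h2
    rw [abs_lt]
    constructor <;> (zify at hi hj; linarith)
  apply Fin.ext
  omega

theorem packing (p : ℕ) [Fact p.Prime]
    [MeasurableSpace (Fin 2 → ℚ_[p])] [BorelSpace (Fin 2 → ℚ_[p])]
    (μ : Measure (Fin 2 → ℚ_[p])) [μ.IsAddHaarMeasure]
    (hμ : μ {v : Fin 2 → ℚ_[p] | ∀ i, ‖v i‖ ≤ 1} = 1)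
    (S : Set (Fin 2 → ℚ_[p])) (hm : MeasurableSet S)
    (hS : S ⊆ {v : Fin 2 → ℚ_[p] | ∀ i, ‖v i‖ ≤ 1})
    (hsub : ∀ x ∈ S, ∀ y ∈ S, x - y ∈ S)
    (u v : ℚ_[p]) (hu0 : u ≠ 0) (hv0 : v ≠ 0) (hu : ‖u‖ ≤ 1) (hv : ‖v‖ ≤ 1)
    (h1 : ∀ w ∈ S, ‖w 1‖ ≤ ‖v‖) (h2 : ∀ w ∈ S, w 1 = 0 → ‖w 0‖ ≤ ‖u‖) :
    μ S ≤ ENNReal.ofReal (‖u‖ * ‖v‖) := by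
  obtain ⟨α, hα⟩ := exists_pow_norm p u hu0 hu
  obtain ⟨β, hβ⟩ := exists_pow_norm p v hv0 hv
  have hp : (0 : ℝ) < p := by exact_mod_cast (Fact.out : p.Prime).pos
  let t : Fin (p ^ α) × Fin (p ^ β) → (Fin 2 → ℚ_[p]) :=
    fun q => ![((q.1 : ℕ) : ℚ_[p]), ((q.2 : ℕ) : ℚ_[p])]
  have hmeas : ∀ q, MeasurableSet ((fun x => t q + x) ⁻¹' S) := fun q =>
    (measurable_const_add (t q)) hm
  have hdisj : Pairwise (Function.onFun Disjoint fun q => (fun x => t q + x) ⁻¹' S) := by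
    intro q r hqr
    rw [Function.onFun, Set.disjoint_left]
    intro x hx hy
    apply hqr
    have h := hsub _ hx _ hy
    simp only [add_sub_add_right_eq_sub] at h
    have e2 : q.2 = r.2 := by
      apply fin_eq_of_norm
      have := h1 _ h
      rw [hβ] at this
      simpa [t] using this
    have e1 : q.1 = r.1 := by
      apply fin_eq_of_norm
      have := h2 _ h (by simp [t, e2])
      rw [hα] at this
      simpa [t] using this
    exact Prod.ext e1 e2
  have hle : μ (⋃ q, (fun x => t q + x) ⁻¹' S) ≤ 1 := by
    rw [← hμ]
    apply measure_mono
    apply Set.iUnion_subset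
    intro q x hx i
    have hx' := hS hx i
    have ht : ‖t q i‖ ≤ 1 := by
      fin_cases i
      · simpa [t] using Padic.norm_int_le_one (p := p) ((q.1 : ℕ) : ℤ)
      · simpa [t] using Padic.norm_int_le_one (p := p) ((q.2 : ℕ) : ℤ)
    have : x i = (t q + x) i - t q i := by simp
    rw [this]
    exact (padic_sub_le p _ _).trans (max_le hx' ht)
  rw [measure_iUnion hdisj hmeas] at hle
  simp only [measure_preimage_add, tsum_fintype, Finset.sum_const, Finset.card_univ,
    Fintype.card_prod, Fintype.card_fin, nsmul_eq_mul] at hle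
  have hN : (0 : ℝ) < ((p ^ α * p ^ β : ℕ) : ℝ) := by push_cast; positivity
  have he : ‖u‖ * ‖v‖ = (((p ^ α * p ^ β : ℕ) : ℝ))⁻¹ := by
    rw [hα, hβ]
    push_cast
    rw [mul_inv, _root_.zpow_neg, _root_.zpow_neg, zpow_natCast, zpow_natCast]
  rw [he, ENNReal.ofReal_inv_of_pos hN, ENNReal.ofReal_natCast]
  rw [ENNReal.le_inv_iff_mul_le, mul_comm]
  exact hle

/-- The key estimate: for an upper triangular matrix `m = [[a, b], [0, d]]` over `ℚ_p` with
`|a|_p |d|_p = 1` and `C = ℤ_p × ℤ_p`, one has `μ(m·C ∩ C) ≤ min(|a|⁻¹, |d|⁻¹)`, and if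
`b ≠ 0` moreover `μ(m·C ∩ C) ≤ 2 · min(|a|⁻¹, |b|⁻¹, |d|⁻¹)`. -/
theorem measure_triangular_inter_le (p : ℕ) [Fact p.Prime]
    [MeasurableSpace (Fin 2 → ℚ_[p])] [BorelSpace (Fin 2 → ℚ_[p])]
    (μ : Measure (Fin 2 → ℚ_[p])) [μ.IsAddHaarMeasure]
    (hμ : μ {v : Fin 2 → ℚ_[p] | ∀ i, ‖v i‖ ≤ 1} = 1)
    (a b d : ℚ_[p]) (had : ‖a‖ * ‖d‖ = 1) :
    μ ((!![a, b; 0, d]).mulVec '' {v : Fin 2 → ℚ_[p] | ∀ i, ‖v i‖ ≤ 1} ∩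
        {v : Fin 2 → ℚ_[p] | ∀ i, ‖v i‖ ≤ 1}) ≤
      ENNReal.ofReal (min ‖a‖⁻¹ ‖d‖⁻¹) ∧
    (b ≠ 0 →
      μ ((!![a, b; 0, d]).mulVec '' {v : Fin 2 → ℚ_[p] | ∀ i, ‖v i‖ ≤ 1} ∩
          {v : Fin 2 → ℚ_[p] | ∀ i, ‖v i‖ ≤ 1}) ≤
        ENNReal.ofReal (2 * min ‖a‖⁻¹ (min ‖b‖⁻¹ ‖d‖⁻¹))) := by
  have hna : 0 < ‖a‖ := by
    rcases (norm_nonneg a).lt_or_eq with h | h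
    · exact h
    · rw [← h] at had; simp at had
  have hnd : 0 < ‖d‖ := by
    rcases (norm_nonneg d).lt_or_eq with h | h
    · exact h
    · rw [← h] at had; simp at had
  have ha0 : a ≠ 0 := norm_pos_iff.1 hna
  have hd0 : d ≠ 0 := norm_pos_iff.1 hnd
  have hai : ‖a‖⁻¹ = ‖d‖ := by rw [inv_eq_iff_eq_inv]; exact eq_inv_of_mul_eq_one_left had
  have hdi : ‖d‖⁻¹ = ‖a‖ := by rw [← hai, inv_inv]
  set C : Set (Fin 2 → ℚ_[p]) := {v : Fin 2 → ℚ_[p] | ∀ i, ‖v i‖ ≤ 1} with hC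
  have hCc : IsCompact C := by
    have : C = Metric.closedBall 0 1 := by
      ext v
      simp [hC, pi_norm_le_iff_of_nonneg]
    rw [this]
    exact isCompact_closedBall _ _
  have hCsub : ∀ x ∈ C, ∀ y ∈ C, x - y ∈ C := fun x hx y hy i =>
    (padic_sub_le p _ _).trans (max_le (hx i) (hy i))
  set S := (!![a, b; 0, d]).mulVec '' C ∩ C with hSdef
  have hm : MeasurableSet S := by
    have hc : Continuous (!![a, b; 0, d]).mulVec := by fun_prop
    exact ((hCc.image hc).inter hCc).isClosed.measurableSet
  have hS : S ⊆ C := Set.inter_subset_right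
  have hsub : ∀ x ∈ S, ∀ y ∈ S, x - y ∈ S := by
    rintro x ⟨⟨x', hx', rfl⟩, hx⟩ y ⟨⟨y', hy', rfl⟩, hy⟩
    exact ⟨⟨x' - y', hCsub _ hx' _ hy', Matrix.mulVec_sub _ _ _⟩, hCsub _ hx _ hy⟩
  have hmem : ∀ w ∈ S, ∃ x y : ℚ_[p], ‖x‖ ≤ 1 ∧ ‖y‖ ≤ 1 ∧ w 0 = a * x + b * y ∧ w 1 = d * y := by
    rintro w ⟨⟨z, hz, rfl⟩, hw⟩
    refine ⟨z 0, z 1, hz 0, hz 1, ?_, ?_⟩ <;> simp [Matrix.mulVec, dotProduct, Fin.sum_univ_two]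
  have hzero : ∀ w ∈ S, w 1 = 0 → ‖w 0‖ ≤ ‖a‖ := by
    intro w hw h
    obtain ⟨x, y, hx, hy, e0, e1⟩ := hmem w hw
    have hy0 : y = 0 := by
      rw [h] at e1
      exact (mul_eq_zero.1 e1.symm).resolve_left hd0
    rw [e0, hy0, mul_zero, add_zero, norm_mul]
    exact mul_le_of_le_one_right hna.le hx
  have hby : ∀ w ∈ S, ‖b‖ * ‖w 1‖ ≤ ‖d‖ * max 1 ‖a‖ := by
    intro w hw
    obtain ⟨x, y, hx, hy, e0, e1⟩ := hmem w hw
    have hb : b * y = w 0 - a * x := by rw [e0]; ring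
    have h3 : ‖b * y‖ ≤ max 1 ‖a‖ := by
      rw [hb]
      refine (padic_sub_le p _ _).trans (max_le_max (hS hw 0) ?_)
      rw [norm_mul]
      exact mul_le_of_le_one_right hna.le hx
    rw [e1, norm_mul]
    rw [norm_mul] at h3
    calc ‖b‖ * (‖d‖ * ‖y‖) = ‖d‖ * (‖b‖ * ‖y‖) := by ring
      _ ≤ _ := by gcongr
  have first : μ S ≤ ENNReal.ofReal (min ‖a‖⁻¹ ‖d‖⁻¹) := by
    rw [hai, hdi]
    rcases le_total 1 ‖a‖ with h | h
    · have hd1 : ‖d‖ ≤ 1 := by rw [← hai]; exact inv_le_one_of_one_le₀ h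
      rw [min_eq_left (hd1.trans h)]
      have := packing p μ hμ S hm hS hsub 1 d one_ne_zero hd0 (by simp) hd1 (by
        intro w hw
        obtain ⟨x, y, hx, hy, e0, e1⟩ := hmem w hw
        rw [e1, norm_mul]
        exact mul_le_of_le_one_right hnd.le hy) (by
        intro w hw _
        simpa using hS hw 0)
      simpa using this
    · have hd1 : 1 ≤ ‖d‖ := by rw [← hai]; exact (one_le_inv₀ hna).2 h
      rw [min_eq_right (h.trans hd1)]
      have := packing p μ hμ S hm hS hsub a 1 ha0 one_ne_zero h (by simp) (by
        intro w hw
        simpa using hS hw 1) hzero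
      simpa using this
  refine ⟨first, fun hb0 => ?_⟩
  have hnb : 0 < ‖b‖ := norm_pos_iff.2 hb0
  have key : μ S ≤ ENNReal.ofReal (min ‖a‖⁻¹ (min ‖b‖⁻¹ ‖d‖⁻¹)) := by
    by_cases hba : ‖b‖ ≤ ‖a‖
    · have : ‖a‖⁻¹ ≤ ‖b‖⁻¹ := inv_anti₀ hnb hba
      refine first.trans (ENNReal.ofReal_le_ofReal ?_)
      exact le_min (min_le_left _ _) (le_min ((min_le_left _ _).trans this) (min_le_right _ _))
    by_cases hbd : ‖b‖ ≤ ‖d‖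
    · have : ‖d‖⁻¹ ≤ ‖b‖⁻¹ := inv_anti₀ hnb hbd
      refine first.trans (ENNReal.ofReal_le_ofReal ?_)
      exact le_min (min_le_left _ _) (le_min ((min_le_right _ _).trans this) (min_le_right _ _))
    push Not at hba hbd
    have i1 : ‖b‖⁻¹ ≤ ‖a‖⁻¹ := inv_anti₀ hna hba.le
    have i2 : ‖b‖⁻¹ ≤ ‖d‖⁻¹ := inv_anti₀ hnd hbd.le
    rw [min_eq_left i2, min_eq_right i1]
    rcases le_total 1 ‖a‖ with h | h
    · have hb1 : ‖b⁻¹‖ ≤ 1 := by rw [norm_inv]; exact inv_le_one_of_one_le₀ (h.trans hba.le)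
      have := packing p μ hμ S hm hS hsub 1 b⁻¹ one_ne_zero (inv_ne_zero hb0) (by simp) hb1 (by
        intro w hw
        have h4 := hby w hw
        rw [max_eq_right h, mul_comm ‖d‖, had] at h4
        rw [norm_inv, ← one_div, le_div_iff₀ hnb, mul_comm]
        exact h4) (by
        intro w hw _
        simpa using hS hw 0)
      simpa using this
    · have hq : ‖d / b‖ ≤ 1 := by rw [norm_div]; exact (div_le_one hnb).2 hbd.le
      have := packing p μ hμ S hm hS hsub a (d / b) ha0 (div_ne_zero hd0 hb0) h hq (by
        intro w hw
        have h4 := hby w hw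
        rw [max_eq_left h, mul_one] at h4
        rw [norm_div, le_div_iff₀ hnb, mul_comm]
        exact h4) hzero
      rw [norm_div, ← mul_div_assoc, had, one_div] at this
      exact this
  refine key.trans (ENNReal.ofReal_le_ofReal ?_)
  have : 0 ≤ min ‖a‖⁻¹ (min ‖b‖⁻¹ ‖d‖⁻¹) := by positivity
  linarith
end

section
/- Let n ≥ 1 and let μ be an additive Haar measure on ℚ_pⁿ. For every g ∈ GL(n, ℚ_p) and every Borel set A ⊆ ℚ_pⁿ, one has μ(g·A) = |det g|_p · μ(A), where g·A is the image of A under matrix multiplication by g and |·|_p is the p-adic absolute value. -/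
open MeasureTheory Matrix
open scoped ENNReal

namespace PadicDet

variable {p : ℕ} [Fact p.Prime] {n : ℕ}

/-- The scaling property we want to establish for a matrix. -/
def Scales [MeasurableSpace (Fin n → ℚ_[p])] (μ : Measure (Fin n → ℚ_[p]))
    (M : Matrix (Fin n) (Fin n) ℚ_[p]) : Prop :=
  ∀ A : Set (Fin n → ℚ_[p]), μ (M.mulVec '' A) = ENNReal.ofReal ‖M.det‖ * μ A

lemma image_eq_preimage {M N : Matrix (Fin n) (Fin n) ℚ_[p]} (h : M * N = 1)
    (A : Set (Fin n → ℚ_[p])) : M.mulVec '' A = N.mulVec ⁻¹' A := by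
  have h' : N * M = 1 := mul_eq_one_comm.mp h
  refine congrFun (Set.image_eq_preimage_of_inverse ?_ ?_) A
  · intro x; simp [h']
  · intro x; simp [h]

section
variable [MeasurableSpace (Fin n → ℚ_[p])] (μ : Measure (Fin n → ℚ_[p]))

lemma scales_mul {M N : Matrix (Fin n) (Fin n) ℚ_[p]} (hM : Scales μ M) (hN : Scales μ N) :
    Scales μ (M * N) := by
  intro A
  have : (M * N).mulVec '' A = M.mulVec '' (N.mulVec '' A) := by
    rw [Set.image_image]; simp
  rw [this, hM, hN, det_mul, norm_mul, ENNReal.ofReal_mul (norm_nonneg _), mul_assoc]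

lemma scales_one : Scales μ (1 : Matrix (Fin n) (Fin n) ℚ_[p]) := by
  intro A; simp

lemma scales_inv {M N : Matrix (Fin n) (Fin n) ℚ_[p]} (h : M * N = 1) (hM : Scales μ M) :
    Scales μ N := by
  intro A
  have h1 : M.mulVec '' (N.mulVec '' A) = A := by
    rw [Set.image_image]; simp [h]
  have h2 := hM (N.mulVec '' A)
  rw [h1] at h2
  have h3 : ‖N.det‖ * ‖M.det‖ = 1 := by
    rw [← norm_mul, mul_comm, ← det_mul, h]; simp
  rw [h2, ← mul_assoc, ← ENNReal.ofReal_mul (norm_nonneg _), h3]; simp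

variable [BorelSpace (Fin n → ℚ_[p])] [μ.IsAddHaarMeasure]

/-- By uniqueness of Haar measure it suffices to test on one set. -/
lemma scales_of_one {M N : Matrix (Fin n) (Fin n) ℚ_[p]} (h : M * N = 1)
    (B : Set (Fin n → ℚ_[p])) (h0 : μ B ≠ 0) (ht : μ B ≠ ∞)
    (hB : μ (M.mulVec '' B) = ENNReal.ofReal ‖M.det‖ * μ B) : Scales μ M := by
  have h' : N * M = 1 := mul_eq_one_comm.mp h
  let e : (Fin n → ℚ_[p]) ≃ₜ+ (Fin n → ℚ_[p]) :=
    { toFun := N.mulVec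
      invFun := M.mulVec
      left_inv := fun x => by simp [h]
      right_inv := fun x => by simp [h']
      map_add' := fun x y => mulVec_add _ _ _
      continuous_toFun := by fun_prop
      continuous_invFun := by fun_prop }
  have hH : (μ.map e).IsAddHaarMeasure := e.isAddHaarMeasure_map μ
  have hc := Measure.isAddLeftInvariant_eq_smul (μ.map e) μ
  set c := Measure.addHaarScalarFactor (μ.map e) μ
  have key : ∀ A, μ (M.mulVec '' A) = c * μ A := by
    intro A
    rw [image_eq_preimage h]
    have : μ.map e A = μ (e ⁻¹' A) := e.toHomeomorph.toMeasurableEquiv.map_apply A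
    change μ (e ⁻¹' A) = _
    rw [← this, hc]; rfl
  have hcc : (c : ℝ≥0∞) = ENNReal.ofReal ‖M.det‖ := by
    rw [key] at hB
    exact (ENNReal.mul_left_inj h0 ht).mp hB
  intro A
  rw [key, hcc]

/-- A matrix of norm-one determinant preserving a compact neighbourhood of zero. -/
lemma scales_of_preserves {M N : Matrix (Fin n) (Fin n) ℚ_[p]} (h : M * N = 1)
    (hd : ‖M.det‖ = 1) (B : Set (Fin n → ℚ_[p])) (hB0 : B ∈ nhds 0)
    (hB1 : B ⊆ Metric.closedBall 0 1)
    (hM : ∀ x ∈ B, M.mulVec x ∈ B) (hN : ∀ x ∈ B, N.mulVec x ∈ B) : Scales μ M := by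
  refine scales_of_one μ h B (Measure.measure_pos_of_mem_nhds μ hB0).ne'
    ((measure_mono hB1).trans_lt (isCompact_closedBall _ _).measure_lt_top).ne ?_
  have : M.mulVec '' B = B := by
    apply subset_antisymm
    · rintro _ ⟨x, hx, rfl⟩; exact hM x hx
    · intro x hx
      exact ⟨_, hN x hx, by simp [h]⟩
  rw [this, hd]; simp

lemma mem_cb (x : Fin n → ℚ_[p]) : x ∈ Metric.closedBall (0 : Fin n → ℚ_[p]) 1 ↔
    ∀ i, ‖x i‖ ≤ 1 := by
  rw [mem_closedBall_zero_iff, pi_norm_le_iff_of_nonneg zero_le_one]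

lemma transvection_apply (i j : Fin n) (c : ℚ_[p]) (x : Fin n → ℚ_[p]) (k : Fin n) :
    (transvection i j c).mulVec x k = x k + if k = i then c * x j else 0 := by
  simp only [transvection, add_mulVec, one_mulVec, single_mulVec_eq, Pi.add_apply, Pi.smul_apply,
    smul_eq_mul, Pi.single_apply]
  simp

lemma scales_transvection (i j : Fin n) (hij : i ≠ j) (c : ℚ_[p]) :
    Scales μ (transvection i j c) := by
  have hmul : transvection i j c * transvection i j (-c) = 1 := by
    rw [transvection_mul_transvection_same i j hij]; simp
  have aux : ∀ d : ℚ_[p], ‖d‖ = ‖c‖ → ∀ x ∈ Metric.closedBall (0 : Fin n → ℚ_[p]) 1 ∩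
      {x | ‖c * x j‖ ≤ 1}, (transvection i j d).mulVec x ∈ 
      Metric.closedBall (0 : Fin n → ℚ_[p]) 1 ∩ {x | ‖c * x j‖ ≤ 1} := by
    rintro d hd x ⟨hx1, hx2⟩
    rw [mem_cb] at hx1
    refine ⟨(mem_cb _).2 fun k => ?_, ?_⟩
    · rw [transvection_apply]
      split_ifs with hk
      · refine (IsUltrametricDist.norm_add_le_max _ _).trans (max_le (hx1 k) ?_)
        rw [norm_mul, hd, ← norm_mul]; exact hx2
      · simpa using hx1 k
    · simp only [Set.mem_ofPred_eq]
      rw [transvection_apply, if_neg hij.symm, add_zero]; exact hx2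
  refine scales_of_preserves μ hmul (by rw [det_transvection_of_ne i j hij]; simp) _ ?_
    Set.inter_subset_left (aux c rfl) (aux (-c) (norm_neg c))
  refine Filter.inter_mem (Metric.closedBall_mem_nhds _ one_pos) ?_
  have hcont : Continuous fun x : Fin n → ℚ_[p] => ‖c * x j‖ := by fun_prop
  have := hcont.continuousAt.eventually_lt (continuousAt_const (y := (1 : ℝ)) (x := 0)) (by simp)
  filter_upwards [this] with x hx using hx.le

/-- The diagonal matrix with a single nontrivial entry. -/
noncomputable def E (i : Fin n) (a : ℚ_[p]) : Matrix (Fin n) (Fin n) ℚ_[p] :=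
  diagonal (Function.update 1 i a)

lemma E_mul (i : Fin n) (a b : ℚ_[p]) : E i a * E i b = E i (a * b) := by
  simp only [E, diagonal_mul_diagonal]
  congr 1; ext k
  by_cases hk : k = i
  · subst hk; simp
  · simp [hk]

lemma E_one (i : Fin n) : E i (1 : ℚ_[p]) = 1 := by
  simp [E]

lemma E_det (i : Fin n) (a : ℚ_[p]) : (E i a).det = a := by
  rw [E, det_diagonal, Finset.prod_update_of_mem (Finset.mem_univ i)]; simp

lemma E_apply (i : Fin n) (a : ℚ_[p]) (x : Fin n → ℚ_[p]) (k : Fin n) :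
    (E i a).mulVec x k = if k = i then a * x k else x k := by
  rw [E, mulVec_diagonal]
  by_cases hk : k = i
  · subst hk; simp
  · simp [hk]

lemma scales_unit (i : Fin n) (u : ℚ_[p]) (hu : ‖u‖ = 1) : Scales μ (E i u) := by
  have hu0 : u ≠ 0 := by rintro rfl; simp at hu
  have aux : ∀ v : ℚ_[p], ‖v‖ = 1 → ∀ x ∈ Metric.closedBall (0 : Fin n → ℚ_[p]) 1,
      (E i v).mulVec x ∈ Metric.closedBall (0 : Fin n → ℚ_[p]) 1 := by
    intro v hv x hx
    rw [mem_cb] at *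
    intro k
    rw [E_apply]
    split_ifs
    · simpa [hv] using hx k
    · exact hx k
  refine scales_of_preserves μ (N := E i u⁻¹) (by rw [E_mul, mul_inv_cancel₀ hu0, E_one])
    (by rw [E_det, hu]) _ (Metric.closedBall_mem_nhds _ one_pos) subset_rfl
    (aux u hu) (aux _ (by simp [hu]))

lemma existsUnique_digit (x : ℚ_[p]) (hx : ‖x‖ ≤ 1) : ∃! k : ℕ, k < p ∧ ‖x - k‖ < 1 := by
  obtain ⟨y, rfl⟩ : ∃ y : ℤ_[p], (y : ℚ_[p]) = x := ⟨⟨x, hx⟩, rfl⟩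
  have h := PadicInt.existsUnique_mem_range y
  have e : ∀ k : ℕ, (y - (k : ℤ_[p])) ∈ IsLocalRing.maximalIdeal ℤ_[p] ↔
      ‖(y : ℚ_[p]) - k‖ < 1 := by
    intro k
    rw [IsLocalRing.mem_maximalIdeal, PadicInt.mem_nonunits, PadicInt.norm_def, PadicInt.coe_sub,
      PadicInt.coe_natCast]
  simpa only [e] using h

lemma scales_p (i : Fin n) : Scales μ (E i (p : ℚ_[p])) := by
  have hp0 : (p : ℚ_[p]) ≠ 0 := by exact_mod_cast (Fact.out : p.Prime).ne_zero
  have hinv : E i (p : ℚ_[p]) * E i (p : ℚ_[p])⁻¹ = 1 := by rw [E_mul, mul_inv_cancel₀ hp0, E_one]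
  set B := Metric.closedBall (0 : Fin n → ℚ_[p]) 1 with hB
  refine scales_of_one μ hinv B 
    (Measure.measure_pos_of_mem_nhds μ (Metric.closedBall_mem_nhds _ one_pos)).ne'
    (isCompact_closedBall _ _).measure_lt_top.ne ?_
  have himg : (E i (p : ℚ_[p])).mulVec '' B = B ∩ {x | ‖x i‖ < 1} := by
    rw [image_eq_preimage hinv]
    ext x
    have hi : ‖(p : ℚ_[p])⁻¹ * x i‖ ≤ 1 ↔ ‖x i‖ < 1 := by
      have := Padic.norm_le_pow_iff_norm_lt_pow_add_one (x i) (-1)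
      have hpp : (0 : ℝ) < p := by exact_mod_cast (Fact.out : p.Prime).pos
      rw [norm_mul, norm_inv, Padic.norm_p, inv_inv]
      simp only [neg_add_cancel, zpow_zero, _root_.zpow_neg_one] at this
      rw [← this, inv_eq_one_div, le_div_iff₀ hpp, mul_comm]
    simp only [Set.mem_preimage, Set.mem_inter_iff, hB, mem_cb, Set.mem_ofPred_eq, E_apply]
    constructor
    · intro h
      have h1 : ‖x i‖ < 1 := hi.1 (by simpa using h i)
      refine ⟨fun k => ?_, h1⟩
      by_cases hk : k = i
      · subst hk; exact h1.le
      · simpa [hk] using h k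
    · rintro ⟨h1, h2⟩ k
      split_ifs with hk
      · subst hk; exact hi.2 h2
      · exact h1 k
  rw [himg, E_det, Padic.norm_p]
  set U : ℕ → Set (Fin n → ℚ_[p]) := fun k => B ∩ {x | ‖x i - k‖ < 1} with hU
  have hmeas : ∀ k, MeasurableSet (U k) := by
    intro k
    refine Metric.isClosed_closedBall.measurableSet.inter (IsOpen.measurableSet ?_)
    exact isOpen_lt (by fun_prop) continuous_const
  have hBU : B = ⋃ k ∈ Finset.range p, U k := by
    ext x
    simp only [Set.mem_iUnion, Finset.mem_range, hU, Set.mem_inter_iff, Set.mem_ofPred_eq]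
    constructor
    · intro hx
      obtain ⟨k, ⟨h1, h2⟩, -⟩ := existsUnique_digit (x i) ((mem_cb x).1 hx i)
      exact ⟨k, h1, hx, h2⟩
    · rintro ⟨k, -, hx, -⟩; exact hx
  have hdisj : Set.PairwiseDisjoint (↑(Finset.range p)) U := by
    intro k hk l hl hkl
    rw [Function.onFun, Set.disjoint_left]
    rintro x ⟨hx, h1⟩ ⟨-, h2⟩
    simp only [Finset.coe_range, Set.mem_Iio] at hk hl
    exact hkl ((existsUnique_digit (x i) ((mem_cb x).1 hx i)).unique ⟨hk, h1⟩ ⟨hl, h2⟩)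
  have hUk : ∀ k : ℕ, μ (U k) = μ (U 0) := by
    intro k
    have hkn : ‖(k : ℚ_[p])‖ ≤ 1 := by simpa using Padic.norm_int_le_one (p := p) (k : ℤ)
    have : U 0 = (fun x => Pi.single i (k : ℚ_[p]) + x) ⁻¹' (U k) := by
      ext x
      simp only [hU, hB, Set.mem_inter_iff, Set.mem_preimage, mem_cb, Set.mem_ofPred_eq,
        Pi.add_apply, Pi.single_apply, if_true, Nat.cast_zero, sub_zero, add_sub_cancel_left]
      refine and_congr_left fun _ => forall_congr' fun m => ?_
      split_ifs
      · constructor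
        · intro h
          exact (IsUltrametricDist.norm_add_le_max _ _).trans (max_le hkn h)
        · intro h
          have := (IsUltrametricDist.norm_add_le_max ((k : ℚ_[p]) + x m) (-k)).trans
            (max_le h (by rwa [norm_neg]))
          simpa using this
      · simp
    rw [this, measure_preimage_add]
  have hsum : μ B = p * μ (U 0) := by
    conv_lhs => rw [hBU]
    rw [measure_biUnion_finset hdisj (fun k _ => hmeas k), Finset.sum_congr rfl fun k _ => hUk k]
    simp
  have hU0 : B ∩ {x | ‖x i‖ < 1} = U 0 := by simp [hU]
  have hpp : 0 < p := (Fact.out : p.Prime).pos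
  rw [hU0, hsum, ← mul_assoc, ENNReal.ofReal_inv_of_pos (by exact_mod_cast hpp),
    ENNReal.ofReal_natCast, ENNReal.inv_mul_cancel (by exact_mod_cast hpp.ne') (by simp), one_mul]

lemma scales_E (i : Fin n) (a : ℚ_[p]) (ha : a ≠ 0) : Scales μ (E i a) := by
  have hp0 : (p : ℚ_[p]) ≠ 0 := by exact_mod_cast (Fact.out : p.Prime).ne_zero
  have hpr : (p : ℝ) ≠ 0 := by exact_mod_cast (Fact.out : p.Prime).ne_zero
  have hpow : ∀ k : ℕ, Scales μ (E i ((p : ℚ_[p]) ^ k)) := by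
    intro k
    induction k with
    | zero => rw [pow_zero, E_one]; exact scales_one μ
    | succ k ih => rw [pow_succ, ← E_mul]; exact scales_mul μ ih (scales_p μ i)
  have hzpow : ∀ k : ℤ, Scales μ (E i ((p : ℚ_[p]) ^ k)) := by
    intro k
    obtain ⟨m, rfl | rfl⟩ := k.eq_nat_or_neg
    · rw [zpow_natCast]; exact hpow m
    · refine scales_inv μ ?_ (hpow m)
      rw [E_mul, _root_.zpow_neg, zpow_natCast, mul_inv_cancel₀ (pow_ne_zero _ hp0), E_one]
  have hsplit : a = (p : ℚ_[p]) ^ a.valuation * ((p : ℚ_[p]) ^ (-a.valuation) * a) := by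
    rw [← mul_assoc, ← zpow_add₀ hp0]; simp
  rw [hsplit, ← E_mul]
  refine scales_mul μ (hzpow _) (scales_unit μ i _ ?_)
  rw [norm_mul, Padic.norm_p_zpow, Padic.norm_eq_zpow_neg_valuation ha, ← zpow_add₀ hpr]
  simp

lemma scales_diagonal (D : Fin n → ℚ_[p]) (hD : ∀ i, D i ≠ 0) : Scales μ (diagonal D) := by
  have key : ∀ s : Finset (Fin n), Scales μ (diagonal fun i => if i ∈ s then D i else 1) := by
    intro s
    induction s using Finset.induction_on with
    | empty => simpa using scales_one μ
    | insert i s hi ih =>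
      have : (diagonal fun k => if k ∈ insert i s then D k else 1) =
          E i (D i) * diagonal fun k => if k ∈ s then D k else 1 := by
        rw [E, diagonal_mul_diagonal]
        congr 1; ext k
        by_cases hk : k = i
        · subst hk; simp [hi]
        · simp [hk]
      rw [this]
      exact scales_mul μ (scales_E μ i _ (hD i)) ih
  simpa using key Finset.univ

end

end PadicDet

/-- For a Haar measure `μ` on `ℚ_pⁿ`, a matrix `g ∈ GL(n, ℚ_p)` and a Borel set `A`, one has
`μ(g·A) = |det g|_p · μ(A)`. -/
theorem measure_image_mulVec (p : ℕ) [Fact p.Prime] (n : ℕ) (hn : 1 ≤ n)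
    [MeasurableSpace (Fin n → ℚ_[p])] [BorelSpace (Fin n → ℚ_[p])]
    (μ : Measure (Fin n → ℚ_[p])) [μ.IsAddHaarMeasure]
    (g : GL (Fin n) ℚ_[p]) (A : Set (Fin n → ℚ_[p])) (hA : MeasurableSet A) :
    μ ((g : Matrix (Fin n) (Fin n) ℚ_[p]).mulVec '' A) =
      ENNReal.ofReal ‖(g : Matrix (Fin n) (Fin n) ℚ_[p]).det‖ * μ A := by
  have hdet : (g : Matrix (Fin n) (Fin n) ℚ_[p]).det ≠ 0 :=
    ((Matrix.isUnit_iff_isUnit_det _).1 g.isUnit).ne_zero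
  have : PadicDet.Scales μ (g : Matrix (Fin n) (Fin n) ℚ_[p]) := by
    refine diagonal_transvection_induction_of_det_ne_zero (PadicDet.Scales μ) _ hdet ?_ ?_ ?_
    · intro D hD
      refine PadicDet.scales_diagonal μ D fun i => ?_
      rw [det_diagonal] at hD
      exact Finset.prod_ne_zero_iff.1 hD i (Finset.mem_univ i)
    · rintro ⟨i, j, hij, c⟩
      exact PadicDet.scales_transvection μ i j hij c
    · intro M N _ _ hM hN
      exact PadicDet.scales_mul μ hM hN
  exact this A
end
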